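/- arXiv:2206.10054 — 15 statements merged into one kernel-verified Lean document; each statement's English description precedes it below -/
import Mathlib

section
/- The pushforward of the product measure μ_R ⊗ μ_D under the map (r, d) ↦ r·d is the measure on ℝ with Lebesgue density v ↦ (1/(π I)) ∫_v^∞ 4 g_c(w²)/√(1 − v²/w²) dw for v > 0, and density 0 for v ≤ 0. (This is the density of S = R·D.) -/
open MeasureTheory Real Set

/-- `I := ∫₀^∞ g(u) du`, the normalizing integral of the density generator. -/
noncomputable def genI (g : ℝ → ℝ) : ℝ := ∫ u in Ioi (0 : ℝ), g u

/-- The measure on `ℝ` with Lebesgue density `r ↦ 2 r g(r²)/I` for `r > 0`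
(and `0` otherwise): the law of the generator variable `R`. -/
noncomputable def muR (g : ℝ → ℝ) : Measure ℝ :=
  volume.withDensity fun r =>
    ENNReal.ofReal (if 0 < r then 2 * r * g (r ^ 2) / genI g else 0)

/-- The measure on `ℝ` with Lebesgue density `d ↦ 2/(π √(1-d²))` for `0 < d < 1`
(and `0` otherwise): the law of the variable `D`. -/
noncomputable def muD : Measure ℝ :=
  volume.withDensity fun d =>
    ENNReal.ofReal (if 0 < d ∧ d < 1 then 2 / (π * Real.sqrt (1 - d ^ 2)) else 0)

/-- The Rademacher probability measure `(1/2)(δ₋₁ + δ₁)` on `ℝ`. -/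
noncomputable def rademacher : Measure ℝ :=
  (2 : ENNReal)⁻¹ • (Measure.dirac (-1) + Measure.dirac 1)

/-- Multiplicative convolution: the law of a product of independent real variables with densities
`f` and `h` has density `v ↦ ∫ f w * h (v / w) / |w| dw`. -/
lemma map_mul_prod_withDensity {f h : ℝ → ENNReal} (hf : Measurable f) (hh : Measurable h) :
    Measure.map (fun p : ℝ × ℝ => p.1 * p.2)
        ((volume.withDensity f).prod (volume.withDensity h))
      = volume.withDensity fun v => ∫⁻ w, f w * (ENNReal.ofReal |w⁻¹| * h (v / w)) := by
  have hm : Measurable fun p : ℝ × ℝ => p.1 * p.2 := by fun_prop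
  ext s hs
  have hscale : ∀ r : ℝ, r ≠ 0 → volume.withDensity h (Prod.mk r ⁻¹'
      ((fun p : ℝ × ℝ => p.1 * p.2) ⁻¹' s))
        = ∫⁻ v in s, ENNReal.ofReal |r⁻¹| * h (v / r) := by
    intro r hr
    have hms : MeasurableSet ((r * ·) ⁻¹' s) := (measurable_const_mul r) hs
    have hmh : Measurable fun v => h (v / r) := by fun_prop
    calc _ = ∫⁻ d in (r * ·) ⁻¹' s, h (r * d / r) := by
            rw [show Prod.mk r ⁻¹' ((fun p : ℝ × ℝ => p.1 * p.2) ⁻¹' s) = (r * ·) ⁻¹' s from rfl,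
              withDensity_apply _ hms]
            simp [mul_div_cancel_left₀ _ hr]
      _ = _ := by
            rw [← setLIntegral_map hs hmh (measurable_const_mul r), Real.map_volume_mul_left hr,
              Measure.restrict_smul, lintegral_smul_measure, lintegral_const_mul _ hmh,
              smul_eq_mul]
  rw [Measure.map_apply hm hs, Measure.prod_apply (hm hs), withDensity_apply _ hs,
    lintegral_withDensity_eq_lintegral_mul _ hf (measurable_measure_prodMk_left (hm hs)),
    lintegral_lintegral_swap (by fun_prop)]
  refine lintegral_congr_ae ?_
  filter_upwards [Measure.ae_ne volume (0 : ℝ)] with r hr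
  rw [Pi.mul_apply, hscale r hr, lintegral_const_mul (f r) (by fun_prop)]

lemma isFiniteMeasure_muR {g : ℝ → ℝ} (hg_int : IntegrableOn g (Ioi (0 : ℝ))) :
    IsFiniteMeasure (muR g) := by
  refine isFiniteMeasure_withDensity_ofReal (Integrable.hasFiniteIntegral ?_)
  have h := (integrableOn_Ioi_comp_rpow_iff g (two_ne_zero' ℝ)).2 hg_int
  have h' : IntegrableOn (fun r => 2 * r * g (r ^ 2) / genI g) (Ioi (0 : ℝ)) := by
    refine IntegrableOn.congr_fun (h.div_const (genI g)) (fun r hr => ?_) measurableSet_Ioi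
    norm_num
  exact (integrable_indicator_iff measurableSet_Ioi).2 h'

lemma isFiniteMeasure_muD : IsFiniteMeasure muD := by
  refine isFiniteMeasure_withDensity_ofReal (Integrable.hasFiniteIntegral ?_)
  have h : IntegrableOn (fun d => 1 / Real.sqrt (1 - d ^ 2)) (Ioc (0 : ℝ) 1) := by
    refine intervalIntegral.integrableOn_deriv_of_nonneg (g := arcsin) continuous_arcsin.continuousOn
      (fun d hd => ?_) fun d hd => by positivity
    exact hasDerivAt_arcsin (by linarith [hd.1]) (by linarith [hd.2])
  have h' : IntegrableOn (fun d => 2 / (π * Real.sqrt (1 - d ^ 2))) (Ioo (0 : ℝ) 1) := by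
    refine ((h.mono_set Ioo_subset_Ioc_self).const_mul (2 / π)).congr (ae_of_all _ fun d => ?_)
    simp only [div_mul_div_comm, mul_one]
  refine ((integrable_indicator_iff measurableSet_Ioo).2 h').congr (ae_of_all _ fun d => ?_)
  simp [indicator_apply]

/-- The pushforward of `μ_R ⊗ μ_D` under `(r, d) ↦ r·d` is the
measure on `ℝ` with Lebesgue density
`v ↦ (1/(π I)) ∫_v^∞ 4 g(w²)/√(1 - v²/w²) dw` for `v > 0` and `0` for `v ≤ 0`:
the density of `S = R·D`. -/
theorem density_of_S
    (g : ℝ → ℝ) (hg_meas : Measurable g) (hg_nonneg : ∀ u, 0 ≤ g u)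
    (hg_int : IntegrableOn g (Ioi (0 : ℝ))) (hg_pos : 0 < genI g) :
    Measure.map (fun p : ℝ × ℝ => p.1 * p.2) ((muR g).prod muD)
      = volume.withDensity fun v =>
          ENNReal.ofReal
            (if 0 < v then
              (1 / (π * genI g)) *
                ∫ w in Ioi v, 4 * g (w ^ 2) / Real.sqrt (1 - v ^ 2 / w ^ 2)
            else 0) := by
  have hfinR := isFiniteMeasure_muR hg_int
  have hfinD := isFiniteMeasure_muD
  set f : ℝ → ENNReal := fun r =>
    ENNReal.ofReal (if 0 < r then 2 * r * g (r ^ 2) / genI g else 0) with hf_def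
  set h : ℝ → ENNReal := fun d =>
    ENNReal.ofReal (if 0 < d ∧ d < 1 then 2 / (π * Real.sqrt (1 - d ^ 2)) else 0) with hh_def
  have hf : Measurable f := by
    refine (Measurable.ite measurableSet_Ioi ?_ measurable_const).ennreal_ofReal
    fun_prop
  have hh : Measurable h := by
    refine (Measurable.ite measurableSet_Ioo ?_ measurable_const).ennreal_ofReal
    fun_prop
  have hmap : Measure.map (fun p : ℝ × ℝ => p.1 * p.2) ((muR g).prod muD)
      = volume.withDensity fun v => ∫⁻ w, f w * (ENNReal.ofReal |w⁻¹| * h (v / w)) :=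
    map_mul_prod_withDensity hf hh
  have hmeas : Measurable fun v => ∫⁻ w, f w * (ENNReal.ofReal |w⁻¹| * h (v / w)) :=
    Measurable.lintegral_prod_right (by fun_prop)
  have hfin : ∫⁻ v, ∫⁻ w, f w * (ENNReal.ofReal |w⁻¹| * h (v / w)) ≠ ⊤ := by
    rw [← setLIntegral_univ, ← withDensity_apply _ MeasurableSet.univ, ← hmap]
    exact measure_ne_top _ _
  rw [hmap]
  refine withDensity_congr_ae ?_
  filter_upwards [ae_lt_top hmeas hfin] with v hv
  set c := 1 / (π * genI g)
  have hc : 0 < c := by positivity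
  split_ifs with hv0
  · have hpt : ∀ w, f w * (ENNReal.ofReal |w⁻¹| * h (v / w)) = (Ioi v).indicator
        (fun w => ENNReal.ofReal (c * (4 * g (w ^ 2) / Real.sqrt (1 - v ^ 2 / w ^ 2)))) w := by
      intro w
      by_cases hw : v < w
      · have hw0 : 0 < w := hv0.trans hw
        have hg := hg_nonneg (w ^ 2)
        have hd : 0 < v / w ∧ v / w < 1 := ⟨by positivity, (div_lt_one hw0).2 hw⟩
        rw [indicator_of_mem (mem_Ioi.2 hw)]
        simp only [hf_def, hh_def, if_pos hw0, if_pos hd]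
        rw [← ENNReal.ofReal_mul (abs_nonneg _), ← ENNReal.ofReal_mul (by positivity),
          abs_of_pos (inv_pos.2 hw0), div_pow]
        congr 1
        have hs : 0 < Real.sqrt (1 - v ^ 2 / w ^ 2) := by
          rw [Real.sqrt_pos, ← div_pow]
          nlinarith [hd.1, hd.2]
        simp only [c]
        field_simp
        ring
      · rw [indicator_of_notMem (by simpa using hw)]
        by_cases hw0 : 0 < w
        · have hd : ¬ (0 < v / w ∧ v / w < 1) := fun hd => hw ((div_lt_one hw0).1 hd.2)
          simp [hh_def, if_neg hd]
        · simp [hf_def, if_neg hw0]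
    have hnn : ∀ w, 0 ≤ c * (4 * g (w ^ 2) / Real.sqrt (1 - v ^ 2 / w ^ 2)) := fun w => by
      have := hg_nonneg (w ^ 2)
      positivity
    simp only [hpt] at hv ⊢
    rw [lintegral_indicator measurableSet_Ioi] at hv ⊢
    have hmk : Measurable fun w => c * (4 * g (w ^ 2) / Real.sqrt (1 - v ^ 2 / w ^ 2)) := by
      fun_prop
    rw [← integral_const_mul, ofReal_integral_eq_lintegral_ofReal
      (lintegral_ofReal_ne_top_iff_integrable hmk.aestronglyMeasurable
        (ae_of_all _ hnn) |>.1 hv.ne) (ae_of_all _ hnn)]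
  · rw [ENNReal.ofReal_zero, lintegral_eq_zero_iff (by fun_prop)]
    refine ae_of_all _ fun w => ?_
    by_cases hw0 : 0 < w
    · have hd : ¬ (0 < v / w ∧ v / w < 1) := fun hd => hv0 (by
        simpa [hw0.ne'] using mul_pos hd.1 hw0)
      simp [hh_def, if_neg hd]
    · simp [hf_def, if_neg hw0]
end

section
/- The pushforward of the product measure μ_R ⊗ μ_D under the map (r, d) ↦ r·d equals the pushforward of μ_R ⊗ μ_D under the map (r, d) ↦ r·√(1 − d²); that is, S = R·D and T = R·√(1 − D²) have the same distribution. -/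
open MeasureTheory Real Set

theorem muD_apply {A : Set ℝ} (hA : MeasurableSet A) :
    muD A = ∫⁻ x in A ∩ Ioo 0 1, ENNReal.ofReal (2 / (π * √(1 - x ^ 2))) := by
  have hind : (fun d : ℝ => ENNReal.ofReal
      (if 0 < d ∧ d < 1 then 2 / (π * √(1 - d ^ 2)) else 0)) =
      (Ioo 0 1).indicator fun d => ENNReal.ofReal (2 / (π * √(1 - d ^ 2))) := by
    ext d
    by_cases h : 0 < d ∧ d < 1 <;> simp [indicator, h]
  rw [muD, withDensity_apply _ hA, hind, lintegral_indicator measurableSet_Ioo,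
    Measure.restrict_restrict measurableSet_Ioo, inter_comm]

theorem sqrt_one_sub_sq_mem_Ioo {x : ℝ} (hx : x ∈ Ioo (0 : ℝ) 1) :
    √(1 - x ^ 2) ∈ Ioo (0 : ℝ) 1 := by
  obtain ⟨h0, h1⟩ := hx
  refine ⟨Real.sqrt_pos.2 (by nlinarith), ?_⟩
  rw [Real.sqrt_lt' one_pos]
  nlinarith

theorem sqrt_one_sub_sq_sqrt_one_sub_sq {x : ℝ} (hx : x ∈ Ioo (0 : ℝ) 1) :
    √(1 - √(1 - x ^ 2) ^ 2) = x := by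
  obtain ⟨h0, h1⟩ := hx
  rw [Real.sq_sqrt (by nlinarith), sub_sub_cancel, Real.sqrt_sq h0.le]

theorem hasDerivAt_sqrt_one_sub_sq {x : ℝ} (hx : x ∈ Ioo (0 : ℝ) 1) :
    HasDerivAt (fun y : ℝ => √(1 - y ^ 2)) (-x / √(1 - x ^ 2)) x := by
  have h : 1 - x ^ 2 ≠ 0 := by
    obtain ⟨h0, h1⟩ := hx
    nlinarith
  convert ((hasDerivAt_pow 2 x).const_sub 1).sqrt h using 1
  have := (sqrt_one_sub_sq_mem_Ioo hx).1.ne'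
  push_cast
  field_simp

theorem measurable_sqrt_one_sub_sq : Measurable fun x : ℝ => √(1 - x ^ 2) := by
  fun_prop

/-- The law `muD` is invariant under the involution `d ↦ √(1 - d²)` of `(0, 1)`. -/
theorem map_sqrt_one_sub_sq_muD : muD.map (fun x => √(1 - x ^ 2)) = muD := by
  ext A hA
  have hpre := measurable_sqrt_one_sub_sq hA
  have himage : (fun x : ℝ => √(1 - x ^ 2)) '' ((fun x : ℝ => √(1 - x ^ 2)) ⁻¹' A ∩ Ioo 0 1) =
      A ∩ Ioo 0 1 := by
    ext y
    constructor
    · rintro ⟨x, ⟨hxA, hx⟩, rfl⟩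
      exact ⟨hxA, sqrt_one_sub_sq_mem_Ioo hx⟩
    · rintro ⟨hyA, hy⟩
      refine ⟨√(1 - y ^ 2), ⟨?_, sqrt_one_sub_sq_mem_Ioo hy⟩, sqrt_one_sub_sq_sqrt_one_sub_sq hy⟩
      rwa [mem_preimage, sqrt_one_sub_sq_sqrt_one_sub_sq hy]
  have hinj : InjOn (fun x : ℝ => √(1 - x ^ 2))
      ((fun x : ℝ => √(1 - x ^ 2)) ⁻¹' A ∩ Ioo 0 1) :=
    LeftInvOn.injOn (f₁' := fun x : ℝ => √(1 - x ^ 2))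
      fun x hx => sqrt_one_sub_sq_sqrt_one_sub_sq hx.2
  rw [Measure.map_apply measurable_sqrt_one_sub_sq hA, muD_apply hA, muD_apply hpre, ← himage,
    lintegral_image_eq_lintegral_abs_deriv_mul (hpre.inter measurableSet_Ioo)
      (fun x hx => (hasDerivAt_sqrt_one_sub_sq hx.2).hasDerivWithinAt) hinj]
  refine setLIntegral_congr_fun (hpre.inter measurableSet_Ioo) fun x hx => ?_
  have hx0 : 0 < x := hx.2.1
  have hs := (sqrt_one_sub_sq_mem_Ioo hx.2).1
  rw [sqrt_one_sub_sq_sqrt_one_sub_sq hx.2, ← ENNReal.ofReal_mul (abs_nonneg _), abs_div, abs_neg,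
    abs_of_pos hx0, abs_of_pos hs]
  congr 1
  field_simp

/-- The pushforward of `μ_R ⊗ μ_D` under `(r, d) ↦ r·d` equals its
pushforward under `(r, d) ↦ r·√(1 - d²)`; i.e. `S = R·D` and `T = R·√(1 - D²)`
have the same distribution. -/
theorem S_and_T_same_distribution
    (g : ℝ → ℝ) (hg_meas : Measurable g) (hg_nonneg : ∀ u, 0 ≤ g u)
    (hg_int : IntegrableOn g (Ioi (0 : ℝ))) (hg_pos : 0 < genI g) :
    Measure.map (fun p : ℝ × ℝ => p.1 * p.2) ((muR g).prod muD)
      = Measure.map (fun p : ℝ × ℝ => p.1 * Real.sqrt (1 - p.2 ^ 2))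
          ((muR g).prod muD) := by
  have : SFinite (muR g) := by unfold muR; infer_instance
  have : SFinite muD := by unfold muD; infer_instance
  have hprod := Measure.map_prod_map (muR g) muD measurable_id measurable_sqrt_one_sub_sq
  rw [Measure.map_id, map_sqrt_one_sub_sq_muD] at hprod
  conv_lhs => rw [hprod]
  rw [Measure.map_map (by fun_prop)
    (measurable_id.prodMap measurable_sqrt_one_sub_sq)]
  rfl
end

section
/- The pushforward of the product measure μ_R ⊗ μ_D under the map (r, d) ↦ (r·d, r·√(1 − d²)) is the measure on ℝ² with Lebesgue density (s, t) ↦ 4 g_c(s² + t²)/(π I) for s > 0 and t > 0, and density 0 otherwise. (This is the joint density of (S, T) = (R·D, R·√(1 − D²)).) -/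
open MeasureTheory Real Set

/-- The derivative of `(r, d) ↦ (r d, r √(1 - d²))`. -/
noncomputable def fderivRadialCoord (p : ℝ × ℝ) : ℝ × ℝ →L[ℝ] ℝ × ℝ :=
  (Matrix.toLin (.finTwoProd ℝ) (.finTwoProd ℝ)
    !![p.2, p.1; √(1 - p.2 ^ 2), p.1 * (-p.2 / √(1 - p.2 ^ 2))]).toContinuousLinearMap

theorem hasFDerivAt_radialCoord {p : ℝ × ℝ} (hp : 0 < 1 - p.2 ^ 2) :
    HasFDerivAt (fun p : ℝ × ℝ => (p.1 * p.2, p.1 * √(1 - p.2 ^ 2)))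
      (fderivRadialCoord p) p := by
  have hsqrt : HasDerivAt (fun d : ℝ => √(1 - d ^ 2)) (-p.2 / √(1 - p.2 ^ 2)) p.2 := by
    convert ((hasDerivAt_pow 2 p.2).const_sub 1).sqrt hp.ne' using 1
    simp
    ring
  unfold fderivRadialCoord
  rw [Matrix.toLin_finTwoProd_toContinuousLinearMap]
  have hfst : HasFDerivAt (Prod.fst : ℝ × ℝ → ℝ) (.fst ℝ ℝ ℝ) p := hasFDerivAt_fst
  have hsnd : HasFDerivAt (Prod.snd : ℝ × ℝ → ℝ) (.snd ℝ ℝ ℝ) p := hasFDerivAt_snd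
  convert! (hfst.fun_mul hsnd).prodMk (hfst.fun_mul (hsqrt.comp_hasFDerivAt p hsnd)) using 2 <;>
  simp [smul_smul, add_comm]

theorem det_fderivRadialCoord {p : ℝ × ℝ} (hp : 0 < 1 - p.2 ^ 2) :
    (fderivRadialCoord p).det = -(p.1 / √(1 - p.2 ^ 2)) := by
  have hsq : √(1 - p.2 ^ 2) ^ 2 = 1 - p.2 ^ 2 := Real.sq_sqrt hp.le
  have hne : √(1 - p.2 ^ 2) ≠ 0 := (Real.sqrt_pos.2 hp).ne'
  unfold fderivRadialCoord
  simp only [LinearMap.det_toContinuousLinearMap, LinearMap.det_toLin, Matrix.det_fin_two_of]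
  field_simp
  rw [hsq]
  ring

theorem radialCoord_sq_add_sq (r : ℝ) {d : ℝ} (hd : 0 ≤ 1 - d ^ 2) :
    (r * d) ^ 2 + (r * √(1 - d ^ 2)) ^ 2 = r ^ 2 := by
  rw [mul_pow, mul_pow, Real.sq_sqrt hd]
  ring

theorem injOn_radialCoord :
    InjOn (fun p : ℝ × ℝ => (p.1 * p.2, p.1 * √(1 - p.2 ^ 2))) (Ioi 0 ×ˢ Ioo 0 1) := by
  rintro ⟨r, d⟩ ⟨hr, hd0, hd1⟩ ⟨r', d'⟩ ⟨hr', hd0', hd1'⟩ h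
  simp only [mem_Ioi, Prod.mk.injEq] at *
  have hsq : r ^ 2 = r' ^ 2 := by
    rw [← radialCoord_sq_add_sq r (d := d) (by nlinarith),
      ← radialCoord_sq_add_sq r' (d := d') (by nlinarith), h.1, h.2]
  obtain rfl : r = r' := (sq_eq_sq₀ hr.le hr'.le).1 hsq
  exact ⟨rfl, mul_left_cancel₀ hr.ne' h.1⟩

theorem image_radialCoord :
    (fun p : ℝ × ℝ => (p.1 * p.2, p.1 * √(1 - p.2 ^ 2))) '' (Ioi 0 ×ˢ Ioo 0 1) =
      Ioi 0 ×ˢ Ioi 0 := by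
  ext ⟨s, t⟩
  constructor
  · rintro ⟨⟨r, d⟩, ⟨hr, hd0, hd1⟩, h⟩
    simp only [mem_Ioi, Prod.mk.injEq] at *
    rw [← h.1, ← h.2]
    exact ⟨mul_pos hr hd0, mul_pos hr (Real.sqrt_pos.2 (by nlinarith))⟩
  · rintro ⟨hs, ht⟩
    simp only [mem_Ioi] at hs ht
    have hpos : 0 < s ^ 2 + t ^ 2 := by positivity
    have hr : 0 < √(s ^ 2 + t ^ 2) := Real.sqrt_pos.2 hpos
    refine ⟨(√(s ^ 2 + t ^ 2), s / √(s ^ 2 + t ^ 2)), ⟨hr, div_pos hs hr, ?_⟩, ?_⟩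
    · rw [div_lt_one hr]
      exact Real.lt_sqrt_of_sq_lt (by nlinarith)
    · have h : 1 - (s / √(s ^ 2 + t ^ 2)) ^ 2 = (t / √(s ^ 2 + t ^ 2)) ^ 2 := by
        rw [div_pow, div_pow, Real.sq_sqrt hpos.le]
        field_simp
        ring
      simp only [h, Real.sqrt_sq (div_pos ht hr).le, mul_div_cancel₀ _ hr.ne']

/-- Change of variables `(s, t) = (r d, r √(1 - d²))` on the open quadrant. -/
theorem lintegral_comp_radialCoord (f : ℝ × ℝ → ENNReal) :
    ∫⁻ p in Ioi 0 ×ˢ Ioi 0, f p =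
      ∫⁻ p in Ioi 0 ×ˢ Ioo 0 1,
        ENNReal.ofReal (p.1 / √(1 - p.2 ^ 2)) * f (p.1 * p.2, p.1 * √(1 - p.2 ^ 2)) := by
  have hpos : ∀ p ∈ Ioi (0 : ℝ) ×ˢ Ioo (0 : ℝ) 1, 0 < 1 - p.2 ^ 2 := by
    rintro p ⟨-, hd0, hd1⟩
    nlinarith
  have hmeas : MeasurableSet (Ioi (0 : ℝ) ×ˢ Ioo (0 : ℝ) 1) :=
    measurableSet_Ioi.prod measurableSet_Ioo
  rw [← image_radialCoord, lintegral_image_eq_lintegral_abs_det_fderiv_mul volume hmeas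
    (fun p hp => (hasFDerivAt_radialCoord (hpos p hp)).hasFDerivWithinAt) injOn_radialCoord]
  refine setLIntegral_congr_fun hmeas fun p hp => ?_
  have hp1 : (0 : ℝ) < p.1 := hp.1
  simp only [det_fderivRadialCoord (hpos p hp), abs_neg]
  rw [abs_of_nonneg (by positivity)]

/-- The pushforward of `μ_R ⊗ μ_D` under
`(r, d) ↦ (r·d, r·√(1 - d²))` is the measure on `ℝ²` with Lebesgue density
`(s, t) ↦ 4 g(s² + t²)/(π I)` for `s > 0, t > 0` and `0` otherwise: the joint
density of `(S, T)`. -/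
theorem joint_density_of_S_T
    (g : ℝ → ℝ) (hg_meas : Measurable g) (hg_nonneg : ∀ u, 0 ≤ g u)
    (hg_int : IntegrableOn g (Ioi (0 : ℝ))) (hg_pos : 0 < genI g) :
    Measure.map (fun p : ℝ × ℝ => (p.1 * p.2, p.1 * Real.sqrt (1 - p.2 ^ 2)))
        ((muR g).prod muD)
      = (volume : Measure (ℝ × ℝ)).withDensity fun p =>
          ENNReal.ofReal
            (if 0 < p.1 ∧ 0 < p.2 then 4 * g (p.1 ^ 2 + p.2 ^ 2) / (π * genI g)
             else 0) := by
  set F : ℝ × ℝ → ℝ × ℝ := fun p => (p.1 * p.2, p.1 * √(1 - p.2 ^ 2)) with hF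
  have hF_meas : Measurable F := by fun_prop
  have hdR : Measurable fun r : ℝ =>
      ENNReal.ofReal (if 0 < r then 2 * r * g (r ^ 2) / genI g else 0) :=
    (Measurable.ite measurableSet_Ioi (by fun_prop) measurable_const).ennreal_ofReal
  have hdD : Measurable fun d : ℝ =>
      ENNReal.ofReal (if 0 < d ∧ d < 1 then 2 / (π * √(1 - d ^ 2)) else 0) :=
    (Measurable.ite measurableSet_Ioo (by fun_prop) measurable_const).ennreal_ofReal
  ext A hA
  rw [Measure.map_apply hF_meas hA, muR, muD, prod_withDensity hdR hdD,
    withDensity_apply _ (hF_meas hA), withDensity_apply _ hA,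
    ← lintegral_indicator (hF_meas hA), ← lintegral_indicator hA, ← Measure.volume_eq_prod]
  have hR : MeasurableSet (Ioi (0 : ℝ) ×ˢ Ioo (0 : ℝ) 1) :=
    measurableSet_Ioi.prod measurableSet_Ioo
  refine (setLIntegral_eq_of_support_subset (s := Ioi (0 : ℝ) ×ˢ Ioo (0 : ℝ) 1) ?_).symm.trans
    (.trans ?_ (setLIntegral_eq_of_support_subset (s := Ioi (0 : ℝ) ×ˢ Ioi (0 : ℝ)) ?_))
  rotate_left
  · rw [lintegral_comp_radialCoord]
    refine setLIntegral_congr_fun hR ?_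
    rintro ⟨r, d⟩ ⟨hr, hd0, hd1⟩
    simp only [mem_Ioi] at hr hd0 hd1
    have hd : 0 < 1 - d ^ 2 := by nlinarith
    have hsqrt : 0 < √(1 - d ^ 2) := Real.sqrt_pos.2 hd
    have hg := hg_nonneg (r ^ 2)
    by_cases h : F (r, d) ∈ A
    · simp only [indicator, mem_preimage, h, if_true]
      simp only [hF] at h
      simp only [h, if_true, hr, hd0, hd1, mul_pos hr hd0, mul_pos hr hsqrt, and_self,
        radialCoord_sq_add_sq r hd.le]
      rw [← ENNReal.ofReal_mul (by positivity), ← ENNReal.ofReal_mul (by positivity)]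
      congr 1
      field_simp
      ring
    · simp only [indicator, mem_preimage, h, if_false]
      simp only [hF] at h
      simp [h]
  · refine Function.support_subset_iff'.2 fun p hp => indicator_apply_eq_zero.2 fun _ => ?_
    simp only [mem_prod, mem_Ioi] at hp
    simp [hp]
  · refine Function.support_subset_iff'.2 fun p hp => indicator_apply_eq_zero.2 fun _ => ?_
    simp only [mem_prod, mem_Ioi, mem_Ioo, not_and_or] at hp
    rcases hp with hp | hp
    · simp [hp]
    · simp [not_and_or.2 hp]
end

section
/- The pushforward of the product measure μ_R ⊗ μ_D ⊗ ε under the map (r, d, v) ↦ r·d·v is the measure on ℝ with Lebesgue density z ↦ (1/(π I)) ∫_{|z|}^∞ 2 g_c(w²)/√(1 − z²/w²) dw. (This is the density of Z₁ = R·D·V₁ with a Rademacher sign V₁.) -/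
open MeasureTheory Real Set

instance sFinite_muR (g : ℝ → ℝ) : SFinite (muR g) := by unfold muR; infer_instance

instance sFinite_muD : SFinite muD := by unfold muD; infer_instance

instance sFinite_rademacher : SFinite rademacher := by unfold rademacher; infer_instance

theorem map_mul_prod_withDensity_s4 {p q : ℝ → ENNReal} (hp : Measurable p) (hq : Measurable q) :
    Measure.map (fun x : ℝ × ℝ => x.1 * x.2)
        ((volume.withDensity p).prod (volume.withDensity q))
      = volume.withDensity fun z =>
          ∫⁻ r, p r * (q (r⁻¹ * z) * ENNReal.ofReal |r⁻¹|) := by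
  refine Measure.ext_of_lintegral _ fun f hf => ?_
  have hk : Measurable fun x : ℝ × ℝ =>
      p x.2 * (q (x.2⁻¹ * x.1) * ENNReal.ofReal |x.2⁻¹|) := by fun_prop
  have hK : Measurable fun z : ℝ => ∫⁻ r, p r * (q (r⁻¹ * z) * ENNReal.ofReal |r⁻¹|) :=
    hk.lintegral_prod_right'
  have hscale : ∀ r : ℝ, r ≠ 0 →
      ∫⁻ d, q d * f (r * d) = ∫⁻ z, q (r⁻¹ * z) * ENNReal.ofReal |r⁻¹| * f z := by
    intro r hr
    calc ∫⁻ d, q d * f (r * d)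
        = ∫⁻ d, (fun z => q (r⁻¹ * z) * f z) (r * d) := by
          simp only [inv_mul_cancel_left₀ hr]
      _ = ∫⁻ z, q (r⁻¹ * z) * f z ∂(Measure.map (fun d => r * d) volume) := by
          rw [lintegral_map (by fun_prop) (by fun_prop)]
      _ = ∫⁻ z, q (r⁻¹ * z) * ENNReal.ofReal |r⁻¹| * f z := by
          rw [Real.map_volume_mul_left hr, lintegral_smul_measure, smul_eq_mul,
            ← lintegral_const_mul _ (by fun_prop)]
          exact lintegral_congr fun z => by ring
  have hm : Measurable fun r : ℝ => ∫⁻ d, f (r * d) ∂(volume.withDensity q) :=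
    Measurable.lintegral_prod_right' (f := fun x : ℝ × ℝ => f (x.1 * x.2)) (by fun_prop)
  calc ∫⁻ y, f y ∂(Measure.map (fun x : ℝ × ℝ => x.1 * x.2)
          ((volume.withDensity p).prod (volume.withDensity q)))
      = ∫⁻ r, p r * ∫⁻ d, q d * f (r * d) := by
        rw [lintegral_map hf (by fun_prop), lintegral_prod _ (by fun_prop),
          lintegral_withDensity_eq_lintegral_mul _ hp hm]
        refine lintegral_congr fun r => ?_
        simp only [Pi.mul_apply]
        rw [lintegral_withDensity_eq_lintegral_mul _ hq (by fun_prop)]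
        rfl
    _ = ∫⁻ r, ∫⁻ z, p r * (q (r⁻¹ * z) * ENNReal.ofReal |r⁻¹|) * f z := by
        refine lintegral_congr_ae ?_
        filter_upwards [Measure.ae_ne volume (0 : ℝ)] with r hr
        rw [hscale r hr, ← lintegral_const_mul _ (by fun_prop)]
        exact lintegral_congr fun z => by ring
    _ = ∫⁻ z, ∫⁻ r, p r * (q (r⁻¹ * z) * ENNReal.ofReal |r⁻¹|) * f z := by
        refine lintegral_lintegral_swap (Measurable.aemeasurable ?_)
        simp only [Function.uncurry_def]
        fun_prop
    _ = _ := by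
        rw [lintegral_withDensity_eq_lintegral_mul _ hK hf]
        refine lintegral_congr fun z => ?_
        rw [lintegral_mul_const _ (by fun_prop)]
        rfl

theorem map_neg_withDensity {K : ℝ → ENNReal} (hK : Measurable K) :
    Measure.map (fun x : ℝ => -x) (volume.withDensity K)
      = volume.withDensity fun z => K (-z) := by
  refine Measure.ext_of_lintegral _ fun f hf => ?_
  rw [lintegral_map hf (by fun_prop), lintegral_withDensity_eq_lintegral_mul _ hK (by fun_prop),
    lintegral_withDensity_eq_lintegral_mul _ (by fun_prop) hf,
    ← lintegral_neg_eq_self fun z => (K * fun x => f (-x)) z]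
  simp

theorem map_mul_prod_rademacher (μ : Measure ℝ) [SFinite μ] :
    Measure.map (fun x : ℝ × ℝ => x.1 * x.2) (μ.prod rademacher)
      = (2 : ENNReal)⁻¹ • (Measure.map (fun x => -x) μ + μ) := by
  have hm : Measurable fun x : ℝ × ℝ => x.1 * x.2 := by fun_prop
  rw [rademacher, Measure.prod_smul_right, Measure.prod_add, Measure.prod_dirac,
    Measure.prod_dirac, Measure.map_smul, Measure.map_add _ _ hm,
    Measure.map_map hm (by fun_prop), Measure.map_map hm (by fun_prop)]
  simp [Function.comp_def]

theorem lintegral_muR_density_lt_top {g : ℝ → ℝ} (hg_int : IntegrableOn g (Ioi (0 : ℝ))) :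
    ∫⁻ r, ENNReal.ofReal (if 0 < r then 2 * r * g (r ^ 2) / genI g else 0) < ⊤ := by
  refine Integrable.lintegral_lt_top ?_
  have h := (integrableOn_Ioi_comp_rpow_iff' g (p := 2) two_ne_zero).2 hg_int
  have h2 : IntegrableOn (fun r : ℝ => 2 * r * g (r ^ 2) / genI g) (Ioi 0) := by
    refine (Integrable.const_mul h (2 / genI g)).congr (.of_forall fun r => ?_)
    have h1 : (2 : ℝ) - 1 = 1 := by norm_num
    simp only [h1, Real.rpow_one, Real.rpow_two, smul_eq_mul]
    ring
  refine (h2.integrable_indicator measurableSet_Ioi).congr (.of_forall fun r => ?_)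
  simp [indicator]

theorem lintegral_muD_density_lt_top :
    ∫⁻ d, ENNReal.ofReal
      (if 0 < d ∧ d < 1 then 2 / (π * Real.sqrt (1 - d ^ 2)) else 0) < ⊤ := by
  refine Integrable.lintegral_lt_top ?_
  have h : IntegrableOn (fun x : ℝ => 1 / Real.sqrt (1 - x ^ 2)) (Ioc 0 1) :=
    intervalIntegral.integrableOn_deriv_of_nonneg Real.continuous_arcsin.continuousOn
      (fun x hx => Real.hasDerivAt_arcsin (by linarith [hx.1]) hx.2.ne)
      (fun x _ => by positivity)
  have h2 : IntegrableOn (fun x : ℝ => 2 / (π * Real.sqrt (1 - x ^ 2))) (Ioo 0 1) := by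
    refine (Integrable.const_mul (h.mono_set Ioo_subset_Ioc_self) (2 / π)).congr
      (.of_forall fun r => ?_)
    simp only [div_mul_div_comm, mul_one]
  refine (h2.integrable_indicator measurableSet_Ioo).congr (.of_forall fun r => ?_)
  simp [indicator]

/-- For a nonnegative function, finiteness of the lower integral makes the Bochner integral
agree with it. -/
theorem ofReal_integral_eq_lintegral_of_ne_top {α : Type*} [MeasurableSpace α] {μ : Measure α}
    {f : α → ℝ} (hf : AEStronglyMeasurable f μ) (h0 : 0 ≤ᵐ[μ] f)
    (hfin : ∫⁻ x, ENNReal.ofReal (f x) ∂μ ≠ ⊤) :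
    ENNReal.ofReal (∫ x, f x ∂μ) = ∫⁻ x, ENNReal.ofReal (f x) ∂μ :=
  ofReal_integral_eq_lintegral_ofReal
    ((lintegral_ofReal_ne_top_iff_integrable hf h0).1 hfin) h0

/-- The density of `R * D` at `z`. -/
noncomputable def productDensity (g : ℝ → ℝ) (z : ℝ) : ENNReal :=
  ∫⁻ r, ENNReal.ofReal (if 0 < r then 2 * r * g (r ^ 2) / genI g else 0) *
    (ENNReal.ofReal (if 0 < r⁻¹ * z ∧ r⁻¹ * z < 1 then
      2 / (π * Real.sqrt (1 - (r⁻¹ * z) ^ 2)) else 0) * ENNReal.ofReal |r⁻¹|)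

theorem measurable_muR_density {g : ℝ → ℝ} (hg : Measurable g) :
    Measurable fun r : ℝ =>
      ENNReal.ofReal (if 0 < r then 2 * r * g (r ^ 2) / genI g else 0) :=
  (Measurable.ite measurableSet_Ioi (by fun_prop) measurable_const).ennreal_ofReal

theorem measurable_muD_density :
    Measurable fun d : ℝ => ENNReal.ofReal
      (if 0 < d ∧ d < 1 then 2 / (π * Real.sqrt (1 - d ^ 2)) else 0) :=
  (Measurable.ite measurableSet_Ioo (by fun_prop) measurable_const).ennreal_ofReal

theorem measurable_productDensity {g : ℝ → ℝ} (hg : Measurable g) :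
    Measurable (productDensity g) := by
  have hR := measurable_muR_density hg
  have hD := measurable_muD_density
  exact Measurable.lintegral_prod_right' (f := fun x : ℝ × ℝ =>
    ENNReal.ofReal (if 0 < x.2 then 2 * x.2 * g (x.2 ^ 2) / genI g else 0) *
    (ENNReal.ofReal (if 0 < x.2⁻¹ * x.1 ∧ x.2⁻¹ * x.1 < 1 then
      2 / (π * Real.sqrt (1 - (x.2⁻¹ * x.1) ^ 2)) else 0) * ENNReal.ofReal |x.2⁻¹|))
    ((hR.comp measurable_snd).mul ((hD.comp (by fun_prop : Measurable
      fun x : ℝ × ℝ => x.2⁻¹ * x.1)).mul (by fun_prop)))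

theorem map_mul_muR_prod_muD {g : ℝ → ℝ} (hg : Measurable g) :
    Measure.map (fun x : ℝ × ℝ => x.1 * x.2) ((muR g).prod muD)
      = volume.withDensity (productDensity g) :=
  map_mul_prod_withDensity_s4 (measurable_muR_density hg) measurable_muD_density

theorem ae_productDensity_lt_top {g : ℝ → ℝ} (hg : Measurable g)
    (hg_int : IntegrableOn g (Ioi (0 : ℝ))) :
    ∀ᵐ z, productDensity g z < ⊤ := by
  refine ae_lt_top (measurable_productDensity hg) ?_
  have h := congrArg (fun μ : Measure ℝ => μ univ) (map_mul_muR_prod_muD hg)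
  simp only [withDensity_apply _ MeasurableSet.univ, Measure.restrict_univ] at h
  rw [← h, Measure.map_apply (by fun_prop) MeasurableSet.univ, preimage_univ,
    ← univ_prod_univ, Measure.prod_prod, muR, muD,
    withDensity_apply _ MeasurableSet.univ, withDensity_apply _ MeasurableSet.univ,
    Measure.restrict_univ]
  exact (ENNReal.mul_lt_top (lintegral_muR_density_lt_top hg_int)
    lintegral_muD_density_lt_top).ne

theorem productDensity_of_neg (g : ℝ → ℝ) {z : ℝ} (hz : z < 0) : productDensity g z = 0 := by
  refine (lintegral_congr fun r => ?_).trans lintegral_zero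
  by_cases hr : 0 < r
  · have : ¬ 0 < r⁻¹ * z := by
      have := mul_neg_of_pos_of_neg (inv_pos.2 hr) hz
      linarith
    simp [this]
  · simp [hr]

theorem productDensity_of_pos {g : ℝ → ℝ} (hg : Measurable g) (hg_nonneg : ∀ u, 0 ≤ g u)
    (hg_pos : 0 < genI g) {z : ℝ} (hz : 0 < z) :
    productDensity g z = 2 * ∫⁻ w in Ioi z, ENNReal.ofReal
      (1 / (π * genI g) * (2 * g (w ^ 2) / Real.sqrt (1 - z ^ 2 / w ^ 2))) := by
  rw [← lintegral_const_mul _ (by fun_prop), ← lintegral_indicator measurableSet_Ioi]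
  refine lintegral_congr fun w => ?_
  by_cases hw : z < w
  · have hw0 : 0 < w := hz.trans hw
    have h1 : 0 < w⁻¹ * z ∧ w⁻¹ * z < 1 :=
      ⟨by positivity, by rw [inv_mul_lt_iff₀ hw0]; linarith⟩
    have hsq : (w⁻¹ * z) ^ 2 = z ^ 2 / w ^ 2 := by field_simp
    have hg0 := hg_nonneg (w ^ 2)
    rw [indicator_of_mem (mem_Ioi.2 hw), if_pos hw0, if_pos h1, hsq,
      abs_of_pos (inv_pos.2 hw0), ← ENNReal.ofReal_mul (by positivity),
      ← ENNReal.ofReal_mul (by positivity), ← ENNReal.ofReal_ofNat,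
      ← ENNReal.ofReal_mul (by positivity)]
    congr 1
    have hs : 0 < Real.sqrt (1 - z ^ 2 / w ^ 2) := by
      rw [← hsq]
      exact Real.sqrt_pos.2 (by nlinarith [h1.1, h1.2])
    generalize Real.sqrt (1 - z ^ 2 / w ^ 2) = s at hs ⊢
    field_simp
  · rw [indicator_of_notMem (by simpa using hw)]
    by_cases hw0 : 0 < w
    · have : ¬ w⁻¹ * z < 1 := by
        rw [inv_mul_lt_iff₀ hw0]
        linarith
      simp [this]
    · simp [hw0]

theorem half_productDensity_symm {g : ℝ → ℝ} (hg : Measurable g) (hg_nonneg : ∀ u, 0 ≤ g u)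
    (hg_pos : 0 < genI g) {z : ℝ} (hz : z ≠ 0) (hfin : productDensity g |z| < ⊤) :
    (2 : ENNReal)⁻¹ * (productDensity g (-z) + productDensity g z) =
      ENNReal.ofReal ((1 / (π * genI g)) *
        ∫ w in Ioi |z|, 2 * g (w ^ 2) / Real.sqrt (1 - z ^ 2 / w ^ 2)) := by
  have hsum : productDensity g (-z) + productDensity g z = productDensity g |z| := by
    rcases hz.lt_or_gt with h | h
    · rw [productDensity_of_neg g h, abs_of_neg h, add_zero]
    · rw [productDensity_of_neg g (neg_lt_zero.2 h), abs_of_pos h, zero_add]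
  have hK := productDensity_of_pos hg hg_nonneg hg_pos (abs_pos.2 hz)
  rw [sq_abs] at hK
  rw [hK] at hfin
  rw [hsum, hK, ← mul_assoc, ENNReal.inv_mul_cancel two_ne_zero ENNReal.ofNat_ne_top, one_mul,
    ← integral_const_mul]
  refine (ofReal_integral_eq_lintegral_of_ne_top
    (Measurable.aestronglyMeasurable (by fun_prop)) (.of_forall fun w => ?_) ?_).symm
  · have := hg_nonneg (w ^ 2)
    simp only [Pi.zero_apply]
    positivity
  · exact fun h => absurd hfin (by rw [h]; simp)

/-- The pushforward of `μ_R ⊗ μ_D ⊗ ε` under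
`(r, d, v) ↦ r·d·v` is the measure on `ℝ` with Lebesgue density
`z ↦ (1/(π I)) ∫_{|z|}^∞ 2 g(w²)/√(1 - z²/w²) dw`: the density of
`Z₁ = R·D·V₁` with a Rademacher sign `V₁`. -/
theorem density_of_Z1
    (g : ℝ → ℝ) (hg_meas : Measurable g) (hg_nonneg : ∀ u, 0 ≤ g u)
    (hg_int : IntegrableOn g (Ioi (0 : ℝ))) (hg_pos : 0 < genI g) :
    Measure.map (fun p : ℝ × ℝ × ℝ => p.1 * p.2.1 * p.2.2)
        ((muR g).prod (muD.prod rademacher))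
      = volume.withDensity fun z =>
          ENNReal.ofReal
            ((1 / (π * genI g)) *
              ∫ w in Ioi |z|, 2 * g (w ^ 2) / Real.sqrt (1 - z ^ 2 / w ^ 2)) := by
  have hassoc : (muR g).prod (muD.prod rademacher)
      = Measure.map MeasurableEquiv.prodAssoc (((muR g).prod muD).prod rademacher) :=
    Measure.prodAssoc_prod.symm
  have hmap : Measure.map (fun p : ℝ × ℝ × ℝ => p.1 * p.2.1 * p.2.2)
        ((muR g).prod (muD.prod rademacher))
      = Measure.map (fun x : ℝ × ℝ => x.1 * x.2)
        ((Measure.map (fun x : ℝ × ℝ => x.1 * x.2) ((muR g).prod muD)).prod rademacher) := by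
    have hprod := Measure.map_prod_map ((muR g).prod muD) rademacher
      (f := fun x : ℝ × ℝ => x.1 * x.2) (g := id) (by fun_prop) measurable_id
    rw [Measure.map_id] at hprod
    rw [hassoc, hprod, Measure.map_map (by fun_prop) (by fun_prop),
      Measure.map_map (by fun_prop) (by fun_prop)]
    rfl
  have hK := measurable_productDensity hg_meas
  rw [hmap, map_mul_muR_prod_muD hg_meas, map_mul_prod_rademacher, map_neg_withDensity hK,
    ← withDensity_add_left (by fun_prop), ← withDensity_smul _ (by fun_prop)]
  have hfin := ae_productDensity_lt_top hg_meas hg_int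
  have hfin_neg : ∀ᵐ z : ℝ, productDensity g (-z) < ⊤ :=
    (Measure.measurePreserving_neg (volume : Measure ℝ)).quasiMeasurePreserving.ae hfin
  refine withDensity_congr_ae ?_
  filter_upwards [hfin, hfin_neg, Measure.ae_ne volume (0 : ℝ)] with z h1 h2 hz
  refine half_productDensity_symm hg_meas hg_nonneg hg_pos hz ?_
  rcases abs_choice z with h | h <;> rwa [h]
end

section
/- The pushforward of the product measure μ_R ⊗ μ_D ⊗ ε ⊗ ε under the map (r, d, v₁, v₂) ↦ (r·d·v₁, r·√(1 − d²)·v₂) is the measure on ℝ² with Lebesgue density (x, y) ↦ g_c(x² + y²)/(π I). In particular this joint density is symmetric under each of the reflections (x, y) ↦ (−x, y), (x, y) ↦ (x, −y) and (x, y) ↦ (−x, −y). -/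
open MeasureTheory Real Set

/-- The map `(r, d) ↦ (r d, r √(1 - d²))`, i.e. polar coordinates with the angle replaced by its
cosine. -/
noncomputable def cosPolar (p : ℝ × ℝ) : ℝ × ℝ := (p.1 * p.2, p.1 * √(1 - p.2 ^ 2))

lemma measurable_cosPolar : Measurable cosPolar := by
  unfold cosPolar
  fun_prop

lemma sq_add_sq_cosPolar {p : ℝ × ℝ} (hp : p ∈ Ioi (0 : ℝ) ×ˢ Ioo (0 : ℝ) 1) :
    (cosPolar p).1 ^ 2 + (cosPolar p).2 ^ 2 = p.1 ^ 2 := by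
  obtain ⟨-, hd0, hd1⟩ := hp
  simp only [cosPolar, mul_pow]
  rw [Real.sq_sqrt (by nlinarith)]
  ring

lemma injOn_cosPolar : InjOn cosPolar (Ioi (0 : ℝ) ×ˢ Ioo (0 : ℝ) 1) := by
  intro p hp q hq h
  have hr : p.1 = q.1 := by
    rw [← sq_eq_sq₀ (le_of_lt hp.1) (le_of_lt hq.1), ← sq_add_sq_cosPolar hp,
      ← sq_add_sq_cosPolar hq, h]
  refine Prod.ext hr (mul_left_cancel₀ (ne_of_gt hp.1 : p.1 ≠ 0) ?_)
  have h1 : p.1 * p.2 = q.1 * q.2 := congrArg Prod.fst h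
  rw [h1, hr]

lemma image_cosPolar :
    cosPolar '' (Ioi (0 : ℝ) ×ˢ Ioo (0 : ℝ) 1) = Ioi (0 : ℝ) ×ˢ Ioi (0 : ℝ) := by
  ext ⟨x, y⟩
  constructor
  · rintro ⟨⟨r, d⟩, ⟨hr, hd0, hd1⟩, h⟩
    rw [← h]
    exact ⟨mul_pos hr hd0, mul_pos hr (Real.sqrt_pos.2 (by nlinarith))⟩
  · rintro ⟨hx, hy⟩
    simp only [mem_Ioi] at hx hy
    have hr : 0 < √(x ^ 2 + y ^ 2) := by positivity
    have hr2 : √(x ^ 2 + y ^ 2) ^ 2 = x ^ 2 + y ^ 2 := Real.sq_sqrt (by positivity)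
    refine ⟨(√(x ^ 2 + y ^ 2), x / √(x ^ 2 + y ^ 2)), ⟨hr, by positivity, ?_⟩, ?_⟩
    · rw [div_lt_one hr]
      exact Real.lt_sqrt_of_sq_lt (by nlinarith)
    · have hd : 1 - (x / √(x ^ 2 + y ^ 2)) ^ 2 = (y / √(x ^ 2 + y ^ 2)) ^ 2 := by
        field_simp
        linarith
      simp only [cosPolar]
      rw [hd, Real.sqrt_sq (by positivity)]
      exact Prod.ext (by field_simp) (by field_simp)

/-- The Jacobian of `cosPolar`. -/
noncomputable def fderivCosPolar (p : ℝ × ℝ) : ℝ × ℝ →L[ℝ] ℝ × ℝ :=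
  (Matrix.toLin (.finTwoProd ℝ) (.finTwoProd ℝ)
    !![p.2, p.1; √(1 - p.2 ^ 2), -(p.1 * p.2 / √(1 - p.2 ^ 2))]).toContinuousLinearMap

lemma hasFDerivAt_cosPolar {p : ℝ × ℝ} (hp : p.2 ∈ Ioo (0 : ℝ) 1) :
    HasFDerivAt cosPolar (fderivCosPolar p) p := by
  have hpos : 0 < 1 - p.2 ^ 2 := by nlinarith [hp.1, hp.2]
  have hs : HasDerivAt (fun d : ℝ => √(1 - d ^ 2)) (-p.2 / √(1 - p.2 ^ 2)) p.2 := by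
    convert! (((hasDerivAt_id p.2).pow 2).const_sub 1).sqrt hpos.ne' using 1
    simp
    field_simp
  have hfst : HasFDerivAt (fun q : ℝ × ℝ => q.1) (.fst ℝ ℝ ℝ) p := hasFDerivAt_fst
  have hsnd : HasFDerivAt (fun q : ℝ × ℝ => q.2) (.snd ℝ ℝ ℝ) p := hasFDerivAt_snd
  unfold fderivCosPolar
  rw [Matrix.toLin_finTwoProd_toContinuousLinearMap]
  convert! (hfst.mul hsnd).prodMk (hfst.mul (hs.comp_hasFDerivAt p hsnd)) using 2
  · simp [add_comm]
  · ext <;> simp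
    ring

lemma abs_det_fderivCosPolar {p : ℝ × ℝ} (hp : p ∈ Ioi (0 : ℝ) ×ˢ Ioo (0 : ℝ) 1) :
    |(fderivCosPolar p).det| = p.1 / √(1 - p.2 ^ 2) := by
  obtain ⟨hr, hd0, hd1⟩ := hp
  rw [mem_Ioi] at hr
  have hpos : 0 < 1 - p.2 ^ 2 := by nlinarith
  have hs : 0 < √(1 - p.2 ^ 2) := Real.sqrt_pos.2 hpos
  have hdet : (fderivCosPolar p).det = -(p.1 / √(1 - p.2 ^ 2)) := by
    unfold fderivCosPolar
    simp only [LinearMap.det_toContinuousLinearMap, LinearMap.det_toLin, Matrix.det_fin_two_of]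
    field_simp
    rw [Real.sq_sqrt hpos.le]
    ring
  rw [hdet, abs_neg, abs_of_pos (by positivity)]

lemma lintegral_quadrant_eq_lintegral_cosPolar (F : ℝ × ℝ → ENNReal) :
    ∫⁻ p in Ioi (0 : ℝ) ×ˢ Ioi (0 : ℝ), F p =
      ∫⁻ p in Ioi (0 : ℝ) ×ˢ Ioo (0 : ℝ) 1,
        ENNReal.ofReal (p.1 / √(1 - p.2 ^ 2)) * F (cosPolar p) := by
  have hm : MeasurableSet (Ioi (0 : ℝ) ×ˢ Ioo (0 : ℝ) 1) := measurableSet_Ioi.prod measurableSet_Ioo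
  rw [← image_cosPolar, lintegral_image_eq_lintegral_abs_det_fderiv_mul volume hm
    (fun p hp => (hasFDerivAt_cosPolar hp.2).hasFDerivWithinAt) injOn_cosPolar]
  exact setLIntegral_congr_fun hm fun p hp => by simp only [abs_det_fderivCosPolar hp]

lemma lintegral_eq_lintegral_Ioi_add_neg {f : ℝ → ENNReal} (hf : Measurable f) :
    ∫⁻ x, f x = ∫⁻ x in Ioi (0 : ℝ), (f x + f (-x)) := by
  rw [lintegral_add_left hf, ← lintegral_add_compl f measurableSet_Ioi (A := Ioi (0 : ℝ)), compl_Ioi]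
  congr 1
  have h := (Measure.measurePreserving_neg (volume : Measure ℝ)).setLIntegral_comp_preimage
    (measurableSet_Iio (a := (0 : ℝ))) hf
  rw [setLIntegral_congr Iio_ae_eq_Iic.symm, ← h]
  simp

/-- The sum of `F` over the four points obtained from `p` by sign changes of the coordinates. -/
noncomputable def signSum (F : ℝ × ℝ → ENNReal) (p : ℝ × ℝ) : ENNReal :=
  F (p.1, p.2) + F (p.1, -p.2) + (F (-p.1, p.2) + F (-p.1, -p.2))

lemma measurable_signSum {F : ℝ × ℝ → ENNReal} (hF : Measurable F) : Measurable (signSum F) := by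
  unfold signSum
  fun_prop

lemma lintegral_eq_lintegral_quadrant {F : ℝ × ℝ → ENNReal} (hF : Measurable F) :
    ∫⁻ p, F p = ∫⁻ p in Ioi (0 : ℝ) ×ˢ Ioi (0 : ℝ), signSum F p := by
  have hS := measurable_signSum hF
  rw [Measure.volume_eq_prod, lintegral_prod _ hF.aemeasurable,
    setLIntegral_prod _ hS.aemeasurable,
    lintegral_eq_lintegral_Ioi_add_neg hF.lintegral_prod_right']
  refine lintegral_congr fun x => ?_
  rw [lintegral_eq_lintegral_Ioi_add_neg (by fun_prop),
    lintegral_eq_lintegral_Ioi_add_neg (by fun_prop), ← lintegral_add_left (by fun_prop)]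
  rfl

lemma lintegral_rademacher (f : ℝ → ENNReal) :
    ∫⁻ v, f v ∂rademacher = 2⁻¹ * (f (-1) + f 1) := by
  simp [rademacher, mul_add]

instance : SFinite rademacher := by
  unfold rademacher
  infer_instance

instance : SFinite muD := by
  unfold muD
  infer_instance

instance (g : ℝ → ℝ) : SFinite (muR g) := by
  unfold muR
  infer_instance

lemma lintegral_rademacher_prod {F : ℝ × ℝ → ENNReal} (hF : Measurable F) (a b : ℝ) :
    ∫⁻ v, F (a * v.1, b * v.2) ∂(rademacher.prod rademacher) = 4⁻¹ * signSum F (a, b) := by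
  have h4 : (4 : ENNReal)⁻¹ = 2⁻¹ * 2⁻¹ := by
    rw [← ENNReal.mul_inv (by simp) (by simp)]
    norm_num
  rw [lintegral_prod _ (by fun_prop)]
  simp only [lintegral_rademacher, signSum, mul_neg, mul_one, h4]
  ring

lemma muR_prod_muD {g : ℝ → ℝ} (hg : Measurable g) (hg_nonneg : ∀ u, 0 ≤ g u)
    (hg_pos : 0 < genI g) :
    (muR g).prod muD = (volume.restrict (Ioi (0 : ℝ) ×ˢ Ioo (0 : ℝ) 1)).withDensity fun p =>
      4 * ENNReal.ofReal (p.1 / √(1 - p.2 ^ 2)) * ENNReal.ofReal (g (p.1 ^ 2) / (π * genI g)) := by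
  unfold muR muD
  have hm : MeasurableSet (Ioi (0 : ℝ) ×ˢ Ioo (0 : ℝ) 1) := measurableSet_Ioi.prod measurableSet_Ioo
  rw [prod_withDensity, ← Measure.volume_eq_prod, ← withDensity_indicator hm]
  · congr 1 with p
    by_cases hp : p ∈ Ioi (0 : ℝ) ×ˢ Ioo (0 : ℝ) 1
    · obtain ⟨hr, hd⟩ := id hp
      rw [mem_Ioi] at hr
      have := hg_nonneg (p.1 ^ 2)
      have h4 : (4 : ENNReal) = ENNReal.ofReal 4 := by simp
      rw [indicator_of_mem hp, if_pos hr, if_pos (c := 0 < p.2 ∧ p.2 < 1) hd, h4, ← ENNReal.ofReal_mul (by positivity),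
        ← ENNReal.ofReal_mul (by positivity), ← ENNReal.ofReal_mul (by positivity)]
      congr 1
      field_simp
      ring
    · rw [indicator_of_notMem hp]
      by_cases hr : 0 < p.1
      · rw [if_neg (c := 0 < p.2 ∧ p.2 < 1) fun hd => hp ⟨hr, hd⟩]
        simp
      · simp [hr]
  · exact (Measurable.ite measurableSet_Ioi (by fun_prop) (by fun_prop)).ennreal_ofReal
  · exact (Measurable.ite measurableSet_Ioo (by fun_prop) (by fun_prop)).ennreal_ofReal

/-- The pushforward of `μ_R ⊗ μ_D ⊗ ε ⊗ ε` under
`(r, d, v₁, v₂) ↦ (r·d·v₁, r·√(1-d²)·v₂)` is the measure on `ℝ²` with Lebesgue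
density `(x, y) ↦ g(x² + y²)/(π I)`; in particular this density is symmetric
under the reflections `(x,y) ↦ (-x,y)`, `(x,y) ↦ (x,-y)` and
`(x,y) ↦ (-x,-y)`. -/
theorem joint_density_of_Z1_Z2
    (g : ℝ → ℝ) (hg_meas : Measurable g) (hg_nonneg : ∀ u, 0 ≤ g u)
    (hg_int : IntegrableOn g (Ioi (0 : ℝ))) (hg_pos : 0 < genI g) :
    (Measure.map (fun p : ℝ × ℝ × ℝ × ℝ =>
          (p.1 * p.2.1 * p.2.2.1, p.1 * Real.sqrt (1 - p.2.1 ^ 2) * p.2.2.2))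
        ((muR g).prod (muD.prod (rademacher.prod rademacher)))
      = (volume : Measure (ℝ × ℝ)).withDensity fun p =>
          ENNReal.ofReal (g (p.1 ^ 2 + p.2 ^ 2) / (π * genI g)))
    ∧ (∀ x y : ℝ,
        g (x ^ 2 + y ^ 2) / (π * genI g) = g ((-x) ^ 2 + y ^ 2) / (π * genI g)
        ∧ g (x ^ 2 + y ^ 2) / (π * genI g) = g (x ^ 2 + (-y) ^ 2) / (π * genI g)
        ∧ g (x ^ 2 + y ^ 2) / (π * genI g)
            = g ((-x) ^ 2 + (-y) ^ 2) / (π * genI g)) := by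
  refine ⟨?_, fun x y => by simp⟩
  have hh : Measurable fun p : ℝ × ℝ =>
      ENNReal.ofReal (g (p.1 ^ 2 + p.2 ^ 2) / (π * genI g)) := by fun_prop
  refine Measure.ext_of_lintegral _ fun f hf => ?_
  have hS := measurable_signSum hf
  have hT := measurable_cosPolar
  rw [lintegral_map hf (by fun_prop), lintegral_withDensity_eq_lintegral_mul _ hh hf,
    lintegral_eq_lintegral_quadrant (hh.mul hf), lintegral_quadrant_eq_lintegral_cosPolar,
    lintegral_prod _ (by fun_prop)]
  have hinner (r : ℝ) :
      ∫⁻ q, f (r * q.1 * q.2.1, r * √(1 - q.1 ^ 2) * q.2.2)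
          ∂(muD.prod (rademacher.prod rademacher))
        = ∫⁻ d, 4⁻¹ * signSum f (cosPolar (r, d)) ∂muD := by
    rw [lintegral_prod _ (by fun_prop)]
    exact lintegral_congr fun d => lintegral_rademacher_prod hf (r * d) (r * √(1 - d ^ 2))
  simp only [hinner]
  rw [← lintegral_prod (fun p : ℝ × ℝ => 4⁻¹ * signSum f (cosPolar p)) (by fun_prop),
    muR_prod_muD hg_meas hg_nonneg hg_pos,
    lintegral_withDensity_eq_lintegral_mul _ (by fun_prop) (by fun_prop)]
  refine setLIntegral_congr_fun (measurableSet_Ioi.prod measurableSet_Ioo) fun p hp => ?_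
  have h4 : (4 : ENNReal) * 4⁻¹ = 1 := ENNReal.mul_inv_cancel (by simp) (by simp)
  have hsum : signSum ((fun p : ℝ × ℝ =>
      ENNReal.ofReal (g (p.1 ^ 2 + p.2 ^ 2) / (π * genI g))) * f) (cosPolar p)
        = ENNReal.ofReal (g (p.1 ^ 2) / (π * genI g)) * signSum f (cosPolar p) := by
    simp only [Pi.mul_apply, signSum, neg_sq, sq_add_sq_cosPolar hp, ← mul_add]
  calc
    _ = 4 * 4⁻¹ * (ENNReal.ofReal (p.1 / √(1 - p.2 ^ 2)) *
          (ENNReal.ofReal (g (p.1 ^ 2) / (π * genI g)) * signSum f (cosPolar p))) := by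
      simp only [Pi.mul_apply]
      ring
    _ = _ := by rw [h4, one_mul, ← hsum]
end

section
/- For every x ∈ ℝ, ∫_ℝ g_c(x² + y²) dy = ∫_{|x|}^∞ 2 g_c(w²)/√(1 − x²/w²) dw, as an equality of extended nonnegative real numbers. (The marginal density of the first coordinate of the bivariate symmetric density (x,y) ↦ g_c(x²+y²)/(π I) coincides with the density of Z₁.) -/
open MeasureTheory Real Set

open scoped ENNReal

/-- The integral over the line of an even function is twice its integral over the positive
half-line. -/
lemma lintegral_eq_two_mul_setLIntegral_Ioi_of_even {f : ℝ → ℝ≥0∞} (hf : ∀ y, f (-y) = f y) :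
    ∫⁻ y, f y = 2 * ∫⁻ y in Ioi (0 : ℝ), f y := by
  have neg_part : ∫⁻ y in Iio (0 : ℝ), f y = ∫⁻ y in Ioi (0 : ℝ), f y := by
    have h := lintegral_image_eq_lintegral_abs_deriv_mul (s := Ioi (0 : ℝ)) (f := fun y ↦ -y)
      (f' := fun _ ↦ -1) measurableSet_Ioi (fun y _ ↦ (hasDerivAt_neg y).hasDerivWithinAt)
      neg_injective.injOn f
    simpa [hf] using h
  rw [← lintegral_add_compl f measurableSet_Ioi (A := Ioi (0 : ℝ)), compl_Ioi,
    setLIntegral_congr Iio_ae_eq_Iic.symm, neg_part, two_mul]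

lemma hasDerivAt_sqrt_sq_sub_sq {x w : ℝ} (hw : |x| < w) :
    HasDerivAt (fun w ↦ √(w ^ 2 - x ^ 2)) (1 / √(1 - x ^ 2 / w ^ 2)) w := by
  have w_pos : 0 < w := (abs_nonneg x).trans_lt hw
  have diff_pos : 0 < w ^ 2 - x ^ 2 := sub_pos.2 (sq_lt_sq.2 (hw.trans_le (le_abs_self w)))
  have sqrt_eq : √(1 - x ^ 2 / w ^ 2) = √(w ^ 2 - x ^ 2) / w := by
    rw [one_sub_div (by positivity), sqrt_div diff_pos.le, sqrt_sq w_pos.le]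
  convert (((hasDerivAt_pow 2 w).sub_const (x ^ 2)).sqrt diff_pos.ne') using 1
  rw [sqrt_eq]
  have := sqrt_pos.2 diff_pos
  simp
  field_simp

lemma image_sqrt_sq_sub_sq_Ioi (x : ℝ) :
    (fun w ↦ √(w ^ 2 - x ^ 2)) '' Ioi |x| = Ioi 0 := by
  ext y
  constructor
  · rintro ⟨w, hw, rfl⟩
    exact sqrt_pos.2 (sub_pos.2 (sq_lt_sq.2 (hw.trans_le (le_abs_self w))))
  · intro (hy : 0 < y)
    refine ⟨√(x ^ 2 + y ^ 2), ?_, ?_⟩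
    · rw [mem_Ioi, ← sqrt_sq_eq_abs]
      exact sqrt_lt_sqrt (sq_nonneg x) (lt_add_of_pos_right _ (by positivity))
    · simp only [sq_sqrt (add_nonneg (sq_nonneg x) (sq_nonneg y)), add_sub_cancel_left,
        sqrt_sq hy.le]

lemma injOn_sqrt_sq_sub_sq_Ioi (x : ℝ) :
    InjOn (fun w ↦ √(w ^ 2 - x ^ 2)) (Ioi |x|) := by
  have sq_lt {w : ℝ} (hw : w ∈ Ioi |x|) : x ^ 2 < w ^ 2 :=
    sq_lt_sq.2 (lt_of_lt_of_le hw (le_abs_self w))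
  intro a ha b hb hab
  have h := (sqrt_inj (sub_pos.2 (sq_lt ha)).le (sub_pos.2 (sq_lt hb)).le).1 hab
  exact (pow_left_inj₀ ((abs_nonneg x).trans ha.le) ((abs_nonneg x).trans hb.le)
    two_ne_zero).1 (sub_left_injective h)

/-- For every `x ∈ ℝ`,
`∫_ℝ g(x² + y²) dy = ∫_{|x|}^∞ 2 g(w²)/√(1 - x²/w²) dw` as an equality in
`[0, ∞]`: the marginal of the bivariate symmetric density coincides with the
density of `Z₁`. -/
theorem marginal_eq_Z1_density
    (g : ℝ → ℝ) (hg_meas : Measurable g) (hg_nonneg : ∀ u, 0 ≤ g u)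
    (hg_int : IntegrableOn g (Ioi (0 : ℝ)))
    (hg_pos : 0 < ∫ u in Ioi (0 : ℝ), g u) (x : ℝ) :
    ∫⁻ y, ENNReal.ofReal (g (x ^ 2 + y ^ 2))
      = ∫⁻ w in Ioi |x|,
          ENNReal.ofReal (2 * g (w ^ 2) / Real.sqrt (1 - x ^ 2 / w ^ 2)) := by
  rw [lintegral_eq_two_mul_setLIntegral_Ioi_of_even (fun y ↦ by rw [neg_sq]),
    ← image_sqrt_sq_sub_sq_Ioi x,
    lintegral_image_eq_lintegral_abs_deriv_mul measurableSet_Ioi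
      (fun w hw ↦ (hasDerivAt_sqrt_sq_sub_sq hw).hasDerivWithinAt) (injOn_sqrt_sq_sub_sq_Ioi x),
    ← lintegral_const_mul' _ _ ENNReal.ofNat_ne_top]
  refine setLIntegral_congr_fun measurableSet_Ioi fun w hw ↦ ?_
  have diff_nonneg : 0 ≤ w ^ 2 - x ^ 2 :=
    sub_nonneg.2 (sq_le_sq.2 (hw.le.trans (le_abs_self w)))
  rw [sq_sqrt diff_nonneg, add_sub_cancel, abs_of_nonneg (by positivity),
    ← ENNReal.ofReal_mul (by positivity), ← ENNReal.ofReal_ofNat 2,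
    ← ENNReal.ofReal_mul zero_le_two]
  congr 1
  ring
end

section
/- For every y ∈ ℝ, writing z := (y − μ₁)/σ, one has ∫₀^∞ f(y, u) du = (1/(σ π I)) ∫_{−∞}^{(μ₂ + ρ z)/√(1 − ρ²)} g_c(z² + w²) dw. (This is the key change-of-variables identity underlying Theorem 1: the unnormalized density of Y* on the event U* > 0.) -/
open MeasureTheory Real Set

/-- The quadratic form of the matrix `Σ = [[σ², ρσ], [ρσ, 1]]`:
`q(a, b) = (a²/σ² - 2ρab/σ + b²)/(1 - ρ²)`. -/
noncomputable def quadForm (σ ρ a b : ℝ) : ℝ :=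
  (a ^ 2 / σ ^ 2 - 2 * ρ * a * b / σ + b ^ 2) / (1 - ρ ^ 2)

/-- The bivariate symmetric joint density with generator `g`, location
`(μ₁, μ₂)` and covariance matrix `Σ = [[σ², ρσ], [ρσ, 1]]`:
`f(y, u) = g(q(y - μ₁, u - μ₂)) / (σ √(1-ρ²) π I)` with `I = ∫₀^∞ g`. -/
noncomputable def bsyDensity (g : ℝ → ℝ) (σ ρ μ₁ μ₂ y u : ℝ) : ℝ :=
  g (quadForm σ ρ (y - μ₁) (u - μ₂)) /
    (σ * Real.sqrt (1 - ρ ^ 2) * π * ∫ t in Ioi (0 : ℝ), g t)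

/-- Affine change of variables `w = A - u / s` from the half-line `u > 0` to `w ≤ A`. -/
theorem setIntegral_Ioi_comp_sub_div (h : ℝ → ℝ) (A : ℝ) {s : ℝ} (hs : 0 < s) :
    ∫ u in Ioi (0 : ℝ), h (A - u / s) = s * ∫ w in Iic A, h w := by
  have hind : (Ioi (0 : ℝ)).indicator (fun u => h (A - u / s))
      = fun u => (Iio A).indicator h (A - u / s) := by
    ext u
    simp [indicator, div_pos_iff_of_pos_right hs]
  rw [integral_Iic_eq_integral_Iio, ← integral_indicator measurableSet_Ioi, hind,
    Measure.integral_comp_div (fun x => (Iio A).indicator h (A - x)),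
    integral_sub_left_eq_self (fun x => (Iio A).indicator h x) volume A,
    integral_indicator measurableSet_Iio, abs_of_pos hs, smul_eq_mul]

/-- Completing the square in `quadForm`. -/
theorem quadForm_sub_eq {σ ρ : ℝ} (hσ : 0 < σ) (hρ : 0 < 1 - ρ ^ 2) (a m u : ℝ) :
    quadForm σ ρ a (u - m) = (a / σ) ^ 2 +
      ((m + ρ * (a / σ)) / √(1 - ρ ^ 2) - u / √(1 - ρ ^ 2)) ^ 2 := by
  rw [← sub_div, div_pow (_ - u), Real.sq_sqrt hρ.le, quadForm]
  field_simp
  ring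

/-- For every `y`, with `z := (y - μ₁)/σ`,
`∫₀^∞ f(y, u) du = (1/(σ π I)) ∫_{-∞}^{(μ₂ + ρz)/√(1-ρ²)} g(z² + w²) dw`:
the unnormalized density of `Y*` on the event `U* > 0`. -/
theorem unnormalized_density_of_Ystar
    (g : ℝ → ℝ) (hg_meas : Measurable g) (hg_nonneg : ∀ u, 0 ≤ g u)
    (hg_int : IntegrableOn g (Ioi (0 : ℝ)))
    (hg_pos : 0 < ∫ u in Ioi (0 : ℝ), g u)
    (σ ρ μ₁ μ₂ : ℝ) (hσ : 0 < σ) (hρ₁ : -1 < ρ) (hρ₂ : ρ < 1) (y : ℝ) :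
    ∫ u in Ioi (0 : ℝ), bsyDensity g σ ρ μ₁ μ₂ y u
      = (1 / (σ * π * ∫ t in Ioi (0 : ℝ), g t)) *
          ∫ w in Iic ((μ₂ + ρ * ((y - μ₁) / σ)) / Real.sqrt (1 - ρ ^ 2)),
            g (((y - μ₁) / σ) ^ 2 + w ^ 2) := by
  have hρ : 0 < 1 - ρ ^ 2 := by nlinarith
  have hs : 0 < √(1 - ρ ^ 2) := Real.sqrt_pos.2 hρ
  simp only [bsyDensity, quadForm_sub_eq hσ hρ]
  rw [integral_div,
    setIntegral_Ioi_comp_sub_div (fun w => g (((y - μ₁) / σ) ^ 2 + w ^ 2)) _ hs]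
  field_simp
end

section
/- For every u ∈ ℝ, ∫_ℝ f(y, u) dy = (1/(π I)) ∫_ℝ g_c((u − μ₂)² + w²) dw; that is, the marginal density of the second coordinate U* of the bivariate symmetric distribution with covariance matrix Σ = [[σ², ρσ], [ρσ, 1]] is the univariate symmetric density with generator g_c, located at μ₂. -/
open MeasureTheory Real Set

/-- Completing the square in `a`: `q(a, b) = b² + ((a - ρσb)/(σ√(1-ρ²)))²`. -/
theorem quadForm_eq_sq_add_sq {σ ρ : ℝ} (hσ : σ ≠ 0) (hρ : 0 < 1 - ρ ^ 2) (a b : ℝ) :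
    quadForm σ ρ a b =
      b ^ 2 + ((a - ρ * σ * b) / (σ * Real.sqrt (1 - ρ ^ 2))) ^ 2 := by
  have hρ' : 1 - ρ ^ 2 ≠ 0 := hρ.ne'
  rw [quadForm, div_pow, mul_pow, Real.sq_sqrt hρ.le]
  field_simp
  ring

/-- For every `u`,
`∫_ℝ f(y, u) dy = (1/(π I)) ∫_ℝ g((u - μ₂)² + w²) dw`: the marginal density of
the second coordinate `U*` is the univariate symmetric density with generator
`g_c`, located at `μ₂`. -/
theorem marginal_density_of_Ustar
    (g : ℝ → ℝ) (hg_meas : Measurable g) (hg_nonneg : ∀ u, 0 ≤ g u)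
    (hg_int : IntegrableOn g (Ioi (0 : ℝ)))
    (hg_pos : 0 < ∫ u in Ioi (0 : ℝ), g u)
    (σ ρ μ₁ μ₂ : ℝ) (hσ : 0 < σ) (hρ₁ : -1 < ρ) (hρ₂ : ρ < 1) (u : ℝ) :
    ∫ y, bsyDensity g σ ρ μ₁ μ₂ y u
      = (1 / (π * ∫ t in Ioi (0 : ℝ), g t)) *
          ∫ w, g ((u - μ₂) ^ 2 + w ^ 2) := by
  have hρ : 0 < 1 - ρ ^ 2 := by nlinarith
  set c := σ * Real.sqrt (1 - ρ ^ 2) with hc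
  have hc_pos : 0 < c := mul_pos hσ (Real.sqrt_pos.mpr hρ)
  set b := u - μ₂ with hb
  have hsubst : ∫ y, g (quadForm σ ρ (y - μ₁) b) = c * ∫ w, g (b ^ 2 + w ^ 2) := by
    calc ∫ y, g (quadForm σ ρ (y - μ₁) b)
        = ∫ y, g (b ^ 2 + ((y - (μ₁ + ρ * σ * b)) / c) ^ 2) := by
          simp only [quadForm_eq_sq_add_sq hσ.ne' hρ, hc, sub_sub]
      _ = ∫ y, g (b ^ 2 + (y / c) ^ 2) :=
          integral_sub_right_eq_self (fun y => g (b ^ 2 + (y / c) ^ 2)) _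
      _ = c * ∫ w, g (b ^ 2 + w ^ 2) := by
          rw [Measure.integral_comp_div (fun w => g (b ^ 2 + w ^ 2)), abs_of_pos hc_pos,
            smul_eq_mul]
  simp only [bsyDensity, integral_div, ← hb, ← hc, hsubst]
  field_simp
end

section
/- Suppose that for z := (y − μ₁)/σ the quantities J(z) := ∫_ℝ g_c(z² + w²) dw and H(μ₂) := (1/(π I)) ∫_{−μ₂}^∞ (∫_ℝ g_c(t² + w²) dw) dt are positive and finite. Then the conditional density of Y* given U* > 0, namely y ↦ (∫₀^∞ f(y, u) du) / (∫_ℝ ∫₀^∞ f(y', u) du dy'), equals y ↦ (1/σ) · (J(z)/(π I)) · G_z((μ₂ + ρ z)/√(1 − ρ²)) / H(μ₂), where G_z(x) := (1/J(z)) ∫_{−∞}^{x} g_c(z² + w²) dw. Moreover the denominator satisfies ∫_ℝ ∫₀^∞ f(y, u) du dy = H(μ₂), i.e. P(U* > 0) = H(μ₂). -/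
open MeasureTheory Real Set

theorem integrable_comp_sq_add_sq {g : ℝ → ℝ} (hg_meas : Measurable g)
    (hg_int : IntegrableOn g (Ioi (0 : ℝ))) :
    Integrable (fun p : ℝ × ℝ => g (p.1 ^ 2 + p.2 ^ 2)) := by
  have hradial : IntegrableOn (fun r : ℝ => r * g (r ^ 2)) (Ioi 0) := by
    have h := (integrableOn_Ioi_comp_rpow_iff' g (two_ne_zero' ℝ)).2 hg_int
    norm_num at h
    exact h
  have hpolar : IntegrableOn (fun p : ℝ × ℝ => p.1 * g (p.1 ^ 2)) polarCoord.target := by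
    rw [polarCoord_target, IntegrableOn, Measure.volume_eq_prod, ← Measure.prod_restrict]
    exact Integrable.comp_fst hradial _
  have hmeas : Measurable fun p : ℝ × ℝ => g (p.1 ^ 2 + p.2 ^ 2) := by fun_prop
  refine ⟨hmeas.aestronglyMeasurable, ?_⟩
  rw [HasFiniteIntegral, ← lintegral_comp_polarCoord_symm]
  refine lt_of_eq_of_lt (setLIntegral_congr_fun polarCoord.open_target.measurableSet ?_) hpolar.2
  intro p hp
  rw [polarCoord_target] at hp
  have hsq : (p.1 * cos p.2) ^ 2 + (p.1 * sin p.2) ^ 2 = p.1 ^ 2 := by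
    linear_combination p.1 ^ 2 * sin_sq_add_cos_sq p.2
  simp only [polarCoord_symm_apply, hsq, smul_eq_mul, enorm_mul,
    Real.enorm_of_nonneg (le_of_lt hp.1)]

theorem setIntegral_Ioi_comp_sub_right (F : ℝ → ℝ) (a m : ℝ) :
    ∫ u in Ioi a, F (u - m) = ∫ t in Ioi (a - m), F t := by
  rw [← (measurePreserving_sub_right volume m).setIntegral_preimage_emb
    (MeasurableEquiv.subRight m).measurableEmbedding F (Ioi (a - m))]
  simp

theorem one_sub_sq_pos {ρ : ℝ} (hρ₁ : -1 < ρ) (hρ₂ : ρ < 1) : 0 < 1 - ρ ^ 2 := by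
  nlinarith

theorem quadForm_eq_left {σ ρ : ℝ} (hρ₁ : -1 < ρ) (hρ₂ : ρ < 1) (a b : ℝ) :
    quadForm σ ρ a b = (a / σ) ^ 2 + ((b - ρ * (a / σ)) / √(1 - ρ ^ 2)) ^ 2 := by
  have h := one_sub_sq_pos hρ₁ hρ₂
  rw [quadForm, div_pow _ (√(1 - ρ ^ 2)), sq_sqrt h.le, div_eq_iff h.ne', add_mul,
    div_mul_cancel₀ _ h.ne']
  ring

theorem quadForm_eq_right {σ ρ : ℝ} (hρ₁ : -1 < ρ) (hρ₂ : ρ < 1) (a b : ℝ) :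
    quadForm σ ρ a b = b ^ 2 + ((a / σ - ρ * b) / √(1 - ρ ^ 2)) ^ 2 := by
  have h := one_sub_sq_pos hρ₁ hρ₂
  rw [quadForm, div_pow _ (√(1 - ρ ^ 2)), sq_sqrt h.le, div_eq_iff h.ne', add_mul,
    div_mul_cancel₀ _ h.ne']
  ring

/-- The upper half-line integral of the generator in `u`, for fixed `y`. -/
theorem setIntegral_Ioi_comp_quadForm (g : ℝ → ℝ) {σ ρ : ℝ} (hρ₁ : -1 < ρ) (hρ₂ : ρ < 1)
    (a μ₂ : ℝ) :
    ∫ u in Ioi (0 : ℝ), g (quadForm σ ρ a (u - μ₂)) =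
      √(1 - ρ ^ 2) * ∫ w in Iic ((μ₂ + ρ * (a / σ)) / √(1 - ρ ^ 2)), g ((a / σ) ^ 2 + w ^ 2) := by
  have hs : 0 < √(1 - ρ ^ 2) := sqrt_pos.2 (one_sub_sq_pos hρ₁ hρ₂)
  simp_rw [quadForm_eq_left hρ₁ hρ₂, sub_sub, div_eq_mul_inv _ (√(1 - ρ ^ 2))]
  rw [setIntegral_Ioi_comp_sub_right
      (fun v => g ((a / σ) ^ 2 + (v * (√(1 - ρ ^ 2))⁻¹) ^ 2)) 0 (μ₂ + ρ * (a / σ)),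
    integral_comp_mul_right_Ioi (fun w => g ((a / σ) ^ 2 + w ^ 2)) _ (inv_pos.2 hs),
    inv_inv, smul_eq_mul, zero_sub, neg_mul, ← integral_comp_neg_Iic]
  simp only [neg_sq]

/-- The integral of the generator in `y`, for fixed `u`. -/
theorem integral_comp_quadForm (g : ℝ → ℝ) {σ ρ : ℝ} (hσ : 0 < σ) (hρ₁ : -1 < ρ) (hρ₂ : ρ < 1)
    (μ₁ b : ℝ) :
    ∫ y, g (quadForm σ ρ (y - μ₁) b) = σ * √(1 - ρ ^ 2) * ∫ w, g (b ^ 2 + w ^ 2) := by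
  simp_rw [quadForm_eq_right hρ₁ hρ₂]
  rw [integral_sub_right_eq_self (fun x => g (b ^ 2 + ((x / σ - ρ * b) / √(1 - ρ ^ 2)) ^ 2)) μ₁,
    Measure.integral_comp_div (fun x => g (b ^ 2 + ((x - ρ * b) / √(1 - ρ ^ 2)) ^ 2)) σ,
    integral_sub_right_eq_self (fun x => g (b ^ 2 + (x / √(1 - ρ ^ 2)) ^ 2)) (ρ * b),
    Measure.integral_comp_div (fun x => g (b ^ 2 + x ^ 2)), abs_of_pos hσ,
    abs_of_nonneg (sqrt_nonneg _), smul_eq_mul, smul_eq_mul, mul_assoc]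

theorem integrable_comp_quadForm {g : ℝ → ℝ} {σ ρ : ℝ} (hσ : 0 < σ) (hρ₁ : -1 < ρ) (hρ₂ : ρ < 1)
    (μ₁ b : ℝ) (h : Integrable fun w => g (b ^ 2 + w ^ 2)) :
    Integrable fun y => g (quadForm σ ρ (y - μ₁) b) := by
  have hs : √(1 - ρ ^ 2) ≠ 0 := (sqrt_pos.2 (one_sub_sq_pos hρ₁ hρ₂)).ne'
  simp_rw [quadForm_eq_right hρ₁ hρ₂]
  exact (((h.comp_div hs).comp_sub_right (ρ * b)).comp_div hσ.ne').comp_sub_right μ₁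

theorem integrable_prod_comp_quadForm {g : ℝ → ℝ} (hg_meas : Measurable g)
    (hg_nonneg : ∀ u, 0 ≤ g u) (hg_int : IntegrableOn g (Ioi (0 : ℝ))) {σ ρ : ℝ} (hσ : 0 < σ)
    (hρ₁ : -1 < ρ) (hρ₂ : ρ < 1) (μ₁ μ₂ : ℝ) :
    Integrable fun p : ℝ × ℝ => g (quadForm σ ρ (p.1 - μ₁) (p.2 - μ₂)) := by
  have hprod := integrable_comp_sq_add_sq hg_meas hg_int
  rw [Measure.volume_eq_prod] at hprod ⊢
  have hmeas : Measurable fun p : ℝ × ℝ => g (quadForm σ ρ (p.1 - μ₁) (p.2 - μ₂)) := by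
    unfold quadForm
    fun_prop
  rw [integrable_prod_iff' hmeas.aestronglyMeasurable]
  refine ⟨?_, ?_⟩
  · filter_upwards [(measurePreserving_sub_right volume μ₂).quasiMeasurePreserving.ae
      hprod.prod_right_ae] with u hu
    exact integrable_comp_quadForm hσ hρ₁ hρ₂ μ₁ (u - μ₂) hu
  · simp_rw [Real.norm_of_nonneg (hg_nonneg _), integral_comp_quadForm g hσ hρ₁ hρ₂]
    exact (hprod.integral_prod_left.comp_sub_right μ₂).const_mul _

theorem integral_setIntegral_bsyDensity {g : ℝ → ℝ} (hg_meas : Measurable g)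
    (hg_nonneg : ∀ u, 0 ≤ g u) (hg_int : IntegrableOn g (Ioi (0 : ℝ))) {σ ρ : ℝ} (hσ : 0 < σ)
    (hρ₁ : -1 < ρ) (hρ₂ : ρ < 1) (μ₁ μ₂ : ℝ) :
    ∫ y, ∫ u in Ioi (0 : ℝ), bsyDensity g σ ρ μ₁ μ₂ y u =
      (1 / (π * ∫ t in Ioi (0 : ℝ), g t)) * ∫ t in Ioi (-μ₂), ∫ w, g (t ^ 2 + w ^ 2) := by
  have hs : 0 < √(1 - ρ ^ 2) := sqrt_pos.2 (one_sub_sq_pos hρ₁ hρ₂)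
  have hint := integrable_prod_comp_quadForm hg_meas hg_nonneg hg_int hσ hρ₁ hρ₂ μ₁ μ₂
  have hint' : Integrable
      (Function.uncurry fun y u : ℝ => g (quadForm σ ρ (y - μ₁) (u - μ₂)))
      ((volume : Measure ℝ).prod (volume.restrict (Ioi (0 : ℝ)))) :=
    hint.mono_measure (Measure.prod_mono le_rfl Measure.restrict_le_self)
  simp only [bsyDensity, integral_div]
  rw [integral_integral_swap hint']
  simp_rw [integral_comp_quadForm g hσ hρ₁ hρ₂, integral_const_mul]
  rw [setIntegral_Ioi_comp_sub_right (fun t => ∫ w, g (t ^ 2 + w ^ 2)), zero_sub]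
  field_simp

/-- (Theorem 1 of the paper.)  Suppose for `z := (y - μ₁)/σ` the
quantities `J(z) := ∫_ℝ g(z² + w²) dw` and
`H(μ₂) := (1/(π I)) ∫_{-μ₂}^∞ (∫_ℝ g(t² + w²) dw) dt` are positive and finite.
Then the conditional density of `Y*` given `U* > 0` equals
`(1/σ) · (J(z)/(π I)) · G_z((μ₂ + ρz)/√(1-ρ²)) / H(μ₂)` where
`G_z(x) := (1/J(z)) ∫_{-∞}^x g(z² + w²) dw`; moreover the denominator satisfies
`∫_ℝ ∫₀^∞ f(y, u) du dy = H(μ₂)`, i.e. `P(U* > 0) = H(μ₂)`. -/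
theorem conditional_density_of_Ystar_given_Ustar_pos
    (g : ℝ → ℝ) (hg_meas : Measurable g) (hg_nonneg : ∀ u, 0 ≤ g u)
    (hg_int : IntegrableOn g (Ioi (0 : ℝ)))
    (hg_pos : 0 < ∫ u in Ioi (0 : ℝ), g u)
    (σ ρ μ₁ μ₂ : ℝ) (hσ : 0 < σ) (hρ₁ : -1 < ρ) (hρ₂ : ρ < 1) (y : ℝ)
    (hJ_fin : Integrable (fun w => g (((y - μ₁) / σ) ^ 2 + w ^ 2)))
    (hJ_pos : 0 < ∫ w, g (((y - μ₁) / σ) ^ 2 + w ^ 2))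
    (hH_fin : IntegrableOn (fun t => ∫ w, g (t ^ 2 + w ^ 2)) (Ioi (-μ₂)))
    (hH_pos : 0 < (1 / (π * ∫ t in Ioi (0 : ℝ), g t)) *
        ∫ t in Ioi (-μ₂), ∫ w, g (t ^ 2 + w ^ 2)) :
    ((∫ u in Ioi (0 : ℝ), bsyDensity g σ ρ μ₁ μ₂ y u) /
        ∫ y', ∫ u in Ioi (0 : ℝ), bsyDensity g σ ρ μ₁ μ₂ y' u
      = (1 / σ) *
          ((∫ w, g (((y - μ₁) / σ) ^ 2 + w ^ 2)) /
            (π * ∫ t in Ioi (0 : ℝ), g t)) *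
          ((1 / ∫ w, g (((y - μ₁) / σ) ^ 2 + w ^ 2)) *
            ∫ w in Iic ((μ₂ + ρ * ((y - μ₁) / σ)) / Real.sqrt (1 - ρ ^ 2)),
              g (((y - μ₁) / σ) ^ 2 + w ^ 2)) /
          ((1 / (π * ∫ t in Ioi (0 : ℝ), g t)) *
            ∫ t in Ioi (-μ₂), ∫ w, g (t ^ 2 + w ^ 2)))
    ∧ (∫ y', ∫ u in Ioi (0 : ℝ), bsyDensity g σ ρ μ₁ μ₂ y' u
        = (1 / (π * ∫ t in Ioi (0 : ℝ), g t)) *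
            ∫ t in Ioi (-μ₂), ∫ w, g (t ^ 2 + w ^ 2)) := by
  have hden := integral_setIntegral_bsyDensity hg_meas hg_nonneg hg_int hσ hρ₁ hρ₂ μ₁ μ₂
  refine ⟨?_, hden⟩
  have hs : 0 < √(1 - ρ ^ 2) := sqrt_pos.2 (one_sub_sq_pos hρ₁ hρ₂)
  rw [hden]
  congr 1
  simp only [bsyDensity, integral_div]
  rw [setIntegral_Ioi_comp_quadForm g hρ₁ hρ₂]
  generalize (y - μ₁) / σ = z at hJ_pos ⊢
  generalize ∫ w, g (z ^ 2 + w ^ 2) = J at hJ_pos ⊢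
  generalize ∫ w in Iic ((μ₂ + ρ * z) / √(1 - ρ ^ 2)), g (z ^ 2 + w ^ 2) = K
  field_simp
end

section
/- Let λ be the measure on ℝ² with Lebesgue density (x, y) ↦ g_c(x² + y²)/(π I). For any real numbers a, b with a² + b² = 1, the pushforward of λ under the linear map (x, y) ↦ a x + b y equals the pushforward of λ under the projection (x, y) ↦ x. In particular, ρ Z₁ + √(1 − ρ²) Z₂ has the same distribution as Z₁ whenever (Z₁, Z₂) has joint density g_c(x² + y²)/(π I) and −1 ≤ ρ ≤ 1. -/
open MeasureTheory Real Set

/-- A measure-preserving map that leaves a density invariant preserves the measure with that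
density. -/
theorem MeasureTheory.MeasurePreserving.withDensity_of_comp_eq {α : Type*} [MeasurableSpace α]
    {μ : Measure α} {T : α → α} (hT : MeasurePreserving T μ μ) {f : α → ENNReal}
    (hf : Measurable f) (hfT : ∀ x, f (T x) = f x) :
    MeasurePreserving T (μ.withDensity f) (μ.withDensity f) := by
  refine ⟨hT.measurable, Measure.ext fun s hs => ?_⟩
  rw [Measure.map_apply hT.measurable hs, withDensity_apply _ (hT.measurable hs),
    withDensity_apply _ hs, ← hT.setLIntegral_comp_preimage hs hf]
  simp only [hfT]

/-- Rotations of the plane preserve Lebesgue measure. -/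
theorem measurePreserving_rotation {a b : ℝ} (hab : a ^ 2 + b ^ 2 = 1) :
    MeasurePreserving (fun p : ℝ × ℝ => (a * p.1 + b * p.2, -b * p.1 + a * p.2)) := by
  refine ⟨by fun_prop, ?_⟩
  let R := Matrix.toLin (Module.Basis.finTwoProd ℝ) (Module.Basis.finTwoProd ℝ) !![a, b; -b, a]
  have hR : ⇑R = fun p : ℝ × ℝ => (a * p.1 + b * p.2, -b * p.1 + a * p.2) := by
    ext p <;> simp [R, Matrix.toLin_finTwoProd_apply]
  have hdet : LinearMap.det R = 1 := by
    rw [LinearMap.det_toLin, Matrix.det_fin_two_of]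
    linarith
  rw [← hR, Measure.map_linearMap_addHaar_eq_smul_addHaar _ (by simp [hdet])]
  simp [hdet]

/-- Let `λ` be the measure on `ℝ²` with Lebesgue density
`(x, y) ↦ g(x² + y²)/(π I)`.  For any reals `a, b` with `a² + b² = 1`, the
pushforward of `λ` under `(x, y) ↦ a x + b y` equals its pushforward under the
projection `(x, y) ↦ x`.  In particular `ρ Z₁ + √(1-ρ²) Z₂` has the same
distribution as `Z₁` whenever `(Z₁, Z₂)` has joint density `g(x²+y²)/(π I)`
and `-1 ≤ ρ ≤ 1`. -/
theorem unit_combination_same_distribution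
    (g : ℝ → ℝ) (hg_meas : Measurable g) (hg_nonneg : ∀ u, 0 ≤ g u)
    (hg_int : IntegrableOn g (Ioi (0 : ℝ)))
    (hg_pos : 0 < ∫ u in Ioi (0 : ℝ), g u)
    (a b : ℝ) (hab : a ^ 2 + b ^ 2 = 1) :
    Measure.map (fun p : ℝ × ℝ => a * p.1 + b * p.2)
        ((volume : Measure (ℝ × ℝ)).withDensity fun p =>
          ENNReal.ofReal
            (g (p.1 ^ 2 + p.2 ^ 2) / (π * ∫ u in Ioi (0 : ℝ), g u)))
      = Measure.map (fun p : ℝ × ℝ => p.1)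
          ((volume : Measure (ℝ × ℝ)).withDensity fun p =>
            ENNReal.ofReal
              (g (p.1 ^ 2 + p.2 ^ 2) / (π * ∫ u in Ioi (0 : ℝ), g u))) := by
  have hf : Measurable fun p : ℝ × ℝ => ENNReal.ofReal
      (g (p.1 ^ 2 + p.2 ^ 2) / (π * ∫ u in Ioi (0 : ℝ), g u)) := by
    fun_prop
  have hR := (measurePreserving_rotation hab).withDensity_of_comp_eq hf fun p => by
    have hp : (a * p.1 + b * p.2) ^ 2 + (-b * p.1 + a * p.2) ^ 2 = p.1 ^ 2 + p.2 ^ 2 := by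
      linear_combination (p.1 ^ 2 + p.2 ^ 2) * hab
    simp only [hp]
  conv_rhs => rw [← hR.map_eq, Measure.map_map measurable_fst hR.measurable]
  rfl
end

section
/- Let λ be the measure on ℝ² with Lebesgue density (x, y) ↦ g_c(x² + y²)/(π I), and let 0 < ρ < 1. Then the pushforward of λ under the map (x, y) ↦ ρ x + √(1 − ρ²) y is the measure on ℝ with Lebesgue density u ↦ (1/(ρ √(1 − ρ²) π I)) ∫_ℝ g_c((x/ρ)² + ((u − x)/√(1 − ρ²))²) dx. -/
open MeasureTheory Real Set

theorem lintegral_comp_mul_left_volume {a : ℝ} (ha : 0 < a) {f : ℝ → ENNReal}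
    (hf : Measurable f) :
    ∫⁻ x, f (a * x) = ENNReal.ofReal (1 / a) * ∫⁻ x, f x := by
  rw [← lintegral_map hf (measurable_const_mul a), Real.map_volume_mul_left ha.ne',
    lintegral_smul_measure, smul_eq_mul, abs_of_pos (inv_pos.2 ha), one_div]

theorem lintegral_comp_div_volume {a : ℝ} (ha : 0 < a) {f : ℝ → ENNReal}
    (hf : Measurable f) :
    ∫⁻ x, f x = ENNReal.ofReal (1 / a) * ∫⁻ x, f (x / a) := by
  have h := lintegral_comp_mul_left_volume ha (f := fun x => f (x / a)) (by fun_prop)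
  simpa [mul_div_cancel_left₀ _ ha.ne'] using h

/-- The linear change of variables `(x, u) ↦ (x / a, (u - x) / b)` in the plane. -/
theorem lintegral_prod_eq_lintegral_combination {a b : ℝ} (ha : 0 < a) (hb : 0 < b)
    {F : ℝ × ℝ → ENNReal} (hF : Measurable F) :
    ∫⁻ p, F p = ENNReal.ofReal (1 / (a * b)) * ∫⁻ u, ∫⁻ x, F (x / a, (u - x) / b) := by
  have hinner : ∀ x : ℝ, ∫⁻ y, F (x, y)
      = ENNReal.ofReal (1 / b) * ∫⁻ u, F (x, (u - a * x) / b) := by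
    intro x
    rw [lintegral_comp_div_volume hb (f := fun y => F (x, y)) (by fun_prop),
      ← lintegral_sub_right_eq_self (fun y => F (x, y / b)) (a * x)]
  have houter : ∀ u : ℝ, ∫⁻ x, F (x, (u - a * x) / b)
      = ENNReal.ofReal (1 / a) * ∫⁻ x, F (x / a, (u - x) / b) := by
    intro u
    rw [lintegral_comp_div_volume ha (f := fun x => F (x, (u - a * x) / b)) (by fun_prop)]
    simp only [mul_div_cancel₀ _ ha.ne']
  rw [Measure.volume_eq_prod, lintegral_prod _ hF.aemeasurable]
  simp only [hinner]
  rw [lintegral_const_mul' _ _ ENNReal.ofReal_ne_top,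
    lintegral_lintegral_swap (by fun_prop)]
  simp only [houter]
  rw [lintegral_const_mul' _ _ ENNReal.ofReal_ne_top, ← mul_assoc,
    ← ENNReal.ofReal_mul (by positivity)]
  congr 2
  field_simp

theorem lintegral_radial_ne_top {g : ℝ → ℝ} (hg : Measurable g)
    (hg_int : IntegrableOn g (Ioi (0 : ℝ))) :
    ∫⁻ p : ℝ × ℝ, ENNReal.ofReal (g (p.1 ^ 2 + p.2 ^ 2)) ≠ ⊤ := by
  have hsq : IntegrableOn (fun r : ℝ => r * g (r ^ 2)) (Ioi (0 : ℝ)) := by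
    have h := ((integrableOn_Ioi_comp_rpow_iff g (p := 2) two_ne_zero).2 hg_int).const_mul
      (1 / 2 : ℝ)
    refine IntegrableOn.congr_fun h (fun r _ => ?_) measurableSet_Ioi
    norm_num
    ring
  rw [← lintegral_comp_polarCoord_symm, polarCoord_target, Measure.volume_eq_prod,
    ← Measure.prod_restrict]
  have hpolar : ∀ p : ℝ × ℝ,
      (polarCoord.symm p).1 ^ 2 + (polarCoord.symm p).2 ^ 2 = p.1 ^ 2 := by
    intro p
    simp only [polarCoord_symm_apply]
    linear_combination p.1 ^ 2 * Real.sin_sq_add_cos_sq p.2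
  simp only [hpolar, smul_eq_mul]
  rw [lintegral_prod _ (by fun_prop)]
  simp only [lintegral_const]
  rw [lintegral_mul_const _ (by fun_prop)]
  refine ENNReal.mul_ne_top ?_ (by simp)
  rw [setLIntegral_congr_fun (g := fun r => ENNReal.ofReal (r * g (r ^ 2))) measurableSet_Ioi
    (fun r hr => (ENNReal.ofReal_mul (le_of_lt hr)).symm)]
  exact hsq.lintegral_lt_top.ne

/-- Let `λ` be the measure on `ℝ²` with Lebesgue density
`(x, y) ↦ g(x² + y²)/(π I)`, and let `0 < ρ < 1`.  The pushforward of `λ`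
under `(x, y) ↦ ρ x + √(1-ρ²) y` is the measure on `ℝ` with Lebesgue density
`u ↦ (1/(ρ √(1-ρ²) π I)) ∫_ℝ g((x/ρ)² + ((u - x)/√(1-ρ²))²) dx`. -/
theorem density_of_rho_combination
    (g : ℝ → ℝ) (hg_meas : Measurable g) (hg_nonneg : ∀ u, 0 ≤ g u)
    (hg_int : IntegrableOn g (Ioi (0 : ℝ)))
    (hg_pos : 0 < ∫ u in Ioi (0 : ℝ), g u)
    (ρ : ℝ) (hρ₁ : 0 < ρ) (hρ₂ : ρ < 1) :
    Measure.map (fun p : ℝ × ℝ => ρ * p.1 + Real.sqrt (1 - ρ ^ 2) * p.2)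
        ((volume : Measure (ℝ × ℝ)).withDensity fun p =>
          ENNReal.ofReal
            (g (p.1 ^ 2 + p.2 ^ 2) / (π * ∫ u in Ioi (0 : ℝ), g u)))
      = volume.withDensity fun u =>
          ENNReal.ofReal
            ((1 / (ρ * Real.sqrt (1 - ρ ^ 2) * π * ∫ t in Ioi (0 : ℝ), g t)) *
              ∫ x, g ((x / ρ) ^ 2 + ((u - x) / Real.sqrt (1 - ρ ^ 2)) ^ 2)) := by
  set I := ∫ u in Ioi (0 : ℝ), g u
  have hs : 0 < Real.sqrt (1 - ρ ^ 2) := Real.sqrt_pos.2 (by nlinarith)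
  set s := Real.sqrt (1 - ρ ^ 2)
  have hfinite : ∀ᵐ u : ℝ,
      ∫⁻ x, ENNReal.ofReal (g ((x / ρ) ^ 2 + ((u - x) / s) ^ 2)) < ⊤ := by
    have h := lintegral_radial_ne_top hg_meas hg_int
    rw [lintegral_prod_eq_lintegral_combination hρ₁ hs (by fun_prop)] at h
    refine ae_lt_top (Measurable.lintegral_prod_right' (f := fun q : ℝ × ℝ =>
      ENNReal.ofReal (g ((q.2 / ρ) ^ 2 + ((q.1 - q.2) / s) ^ 2))) (by fun_prop)) ?_
    intro htop
    refine h ?_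
    simp only [htop]
    exact ENNReal.mul_top (ENNReal.ofReal_pos.2 (by positivity)).ne'
  ext A hA
  have hT : Measurable fun p : ℝ × ℝ => ρ * p.1 + s * p.2 := by fun_prop
  rw [Measure.map_apply hT hA, withDensity_apply _ (hT hA), withDensity_apply _ hA,
    ← lintegral_indicator (hT hA), ← lintegral_indicator hA,
    lintegral_prod_eq_lintegral_combination hρ₁ hs
      (Measurable.indicator (by fun_prop) (hT hA)),
    ← lintegral_const_mul' _ _ ENNReal.ofReal_ne_top]
  refine lintegral_congr_ae ?_
  filter_upwards [hfinite] with u hu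
  have hcomb : ∀ x : ℝ, ρ * (x / ρ) + s * ((u - x) / s) = u := by
    intro x
    field_simp
    ring
  by_cases huA : u ∈ A
  · have hint : Integrable fun x => g ((x / ρ) ^ 2 + ((u - x) / s) ^ 2) :=
      ⟨Measurable.aestronglyMeasurable (by fun_prop),
        (hasFiniteIntegral_iff_ofReal (ae_of_all _ fun _ => hg_nonneg _)).2 hu⟩
    simp only [indicator, mem_preimage, hcomb, huA, if_true]
    rw [← ofReal_integral_eq_lintegral_ofReal (hint.div_const _)
        (ae_of_all _ fun _ => div_nonneg (hg_nonneg _) (by positivity)),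
      ← ENNReal.ofReal_mul (by positivity), integral_div]
    congr 1
    field_simp
  · simp [indicator, hcomb, huA]
end

section
/- Let σ > 0, −1 < ρ < 1 and μ₁, μ₂ ∈ ℝ, and consider the bivariate normal joint density f(y, u) := (1/(2π σ √(1 − ρ²))) exp(−q(y − μ₁, u − μ₂)/2). Then for every y ∈ ℝ, writing z := (y − μ₁)/σ: (i) ∫₀^∞ f(y, u) du = (1/σ) φ(z) Φ((μ₂ + ρ z)/√(1 − ρ²)); (ii) ∫_ℝ ∫₀^∞ f(y, u) du dy = Φ(μ₂). Consequently the conditional density of Y* given U* > 0 is y ↦ (1/σ) φ(z) Φ((μ₂ + ρ z)/√(1 − ρ²)) / Φ(μ₂). -/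
open MeasureTheory Real Set

/-- The standard normal probability density function `φ`. -/
noncomputable def stdNormalPDF (t : ℝ) : ℝ := Real.exp (-t ^ 2 / 2) / Real.sqrt (2 * π)

/-- The standard normal cumulative distribution function `Φ`. -/
noncomputable def stdNormalCDF (x : ℝ) : ℝ := ∫ t in Iic x, stdNormalPDF t

/-- The bivariate normal joint density with location `(μ₁, μ₂)` and covariance
matrix `Σ = [[σ², ρσ], [ρσ, 1]]`. -/
noncomputable def binormalDensity (σ ρ μ₁ μ₂ y u : ℝ) : ℝ :=
  (1 / (2 * π * σ * Real.sqrt (1 - ρ ^ 2))) *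
    Real.exp (-(quadForm σ ρ (y - μ₁) (u - μ₂)) / 2)

theorem stdNormalPDF_neg (t : ℝ) : stdNormalPDF (-t) = stdNormalPDF t := by
  simp [stdNormalPDF]

theorem stdNormalPDF_eq (t : ℝ) :
    stdNormalPDF t = Real.exp (-(1 / 2) * t ^ 2) / Real.sqrt (2 * π) := by
  rw [stdNormalPDF]; ring_nf

theorem integrable_stdNormalPDF : Integrable stdNormalPDF := by
  simp_rw [funext stdNormalPDF_eq]
  exact (integrable_exp_neg_mul_sq (by norm_num)).div_const _

theorem integral_stdNormalPDF : ∫ t, stdNormalPDF t = 1 := by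
  simp_rw [stdNormalPDF_eq]
  rw [integral_div, integral_gaussian, show π / (1 / 2) = 2 * π by ring]
  exact div_self (by positivity)

theorem integrable_stdNormalPDF_affine (c : ℝ) {s : ℝ} (hs : 0 < s) :
    Integrable fun x => stdNormalPDF ((x - c) / s) :=
  (integrable_stdNormalPDF.comp_div hs.ne').comp_sub_right c

theorem integral_stdNormalPDF_affine (c : ℝ) {s : ℝ} (hs : 0 < s) :
    ∫ x, stdNormalPDF ((x - c) / s) = s := by
  rw [integral_sub_right_eq_self (fun x => stdNormalPDF (x / s)) c,
    Measure.integral_comp_div, integral_stdNormalPDF, abs_of_pos hs, smul_eq_mul, mul_one]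

theorem setIntegral_Ioi_comp_sub_left (f : ℝ → ℝ) (a c : ℝ) :
    ∫ x in Ioi a, f (c - x) = ∫ x in Iic (c - a), f x := by
  rw [integral_Iic_eq_integral_Iio, ← integral_indicator measurableSet_Ioi,
    ← integral_indicator measurableSet_Iio,
    ← integral_sub_left_eq_self ((Iio (c - a)).indicator f) volume c]
  congr with x
  simp [indicator]

theorem setIntegral_Ioi_stdNormalPDF_affine (c : ℝ) {s : ℝ} (hs : 0 < s) :
    ∫ u in Ioi 0, stdNormalPDF ((u - c) / s) = s * stdNormalCDF (c / s) := by
  have h (u : ℝ) : stdNormalPDF ((u - c) / s) = stdNormalPDF (c / s - s⁻¹ * u) := by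
    rw [← stdNormalPDF_neg]; ring_nf
  simp_rw [h]
  rw [integral_comp_mul_left_Ioi (fun u => stdNormalPDF (c / s - u)) 0 (inv_pos.2 hs),
    setIntegral_Ioi_comp_sub_left]
  simp [stdNormalCDF]

theorem stdNormalPDF_mul_stdNormalPDF (a b : ℝ) :
    stdNormalPDF a * stdNormalPDF b = Real.exp (-(a ^ 2 + b ^ 2) / 2) / (2 * π) := by
  rw [stdNormalPDF, stdNormalPDF, div_mul_div_comm, ← Real.exp_add,
    Real.mul_self_sqrt (by positivity)]
  ring_nf

section

variable {σ ρ : ℝ}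

theorem binormalDensity_eq_of_quadForm (μ₁ μ₂ y u a b : ℝ)
    (h : quadForm σ ρ (y - μ₁) (u - μ₂) = a ^ 2 + b ^ 2) :
    binormalDensity σ ρ μ₁ μ₂ y u =
      1 / (σ * Real.sqrt (1 - ρ ^ 2)) * (stdNormalPDF a * stdNormalPDF b) := by
  rw [binormalDensity, h, stdNormalPDF_mul_stdNormalPDF]
  simp only [div_eq_mul_inv, mul_inv]
  ring

/-- The joint density as the marginal of `Y*` times the conditional density of `U*`. -/
theorem binormalDensity_eq_marginal_left (hσ : 0 < σ) (hρ : 0 < 1 - ρ ^ 2) (μ₁ μ₂ y u : ℝ) :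
    binormalDensity σ ρ μ₁ μ₂ y u =
      1 / (σ * Real.sqrt (1 - ρ ^ 2)) * (stdNormalPDF ((y - μ₁) / σ) *
        stdNormalPDF ((u - (μ₂ + ρ * ((y - μ₁) / σ))) / Real.sqrt (1 - ρ ^ 2))) := by
  apply binormalDensity_eq_of_quadForm
  rw [quadForm, div_pow _ (Real.sqrt _), Real.sq_sqrt hρ.le]
  field_simp
  ring

/-- The joint density as the marginal of `U*` times the conditional density of `Y*`. -/
theorem binormalDensity_eq_marginal_right (hσ : 0 < σ) (hρ : 0 < 1 - ρ ^ 2) (μ₁ μ₂ y u : ℝ) :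
    binormalDensity σ ρ μ₁ μ₂ y u =
      1 / (σ * Real.sqrt (1 - ρ ^ 2)) * (stdNormalPDF (u - μ₂) *
        stdNormalPDF ((y - (μ₁ + σ * ρ * (u - μ₂))) / (σ * Real.sqrt (1 - ρ ^ 2)))) := by
  apply binormalDensity_eq_of_quadForm
  rw [quadForm, div_pow _ (σ * _), mul_pow, Real.sq_sqrt hρ.le]
  field_simp
  ring

theorem binormalDensity_nonneg (hσ : 0 < σ) (μ₁ μ₂ y u : ℝ) :
    0 ≤ binormalDensity σ ρ μ₁ μ₂ y u := by
  unfold binormalDensity; positivity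

theorem integral_binormalDensity_left (hσ : 0 < σ) (hρ : 0 < 1 - ρ ^ 2) (μ₁ μ₂ u : ℝ) :
    ∫ y, binormalDensity σ ρ μ₁ μ₂ y u = stdNormalPDF (u - μ₂) := by
  have hs : 0 < σ * Real.sqrt (1 - ρ ^ 2) := by positivity
  simp_rw [binormalDensity_eq_marginal_right hσ hρ]
  rw [integral_const_mul, integral_const_mul, integral_stdNormalPDF_affine _ hs]
  field_simp

theorem integrable_binormalDensity (hσ : 0 < σ) (hρ : 0 < 1 - ρ ^ 2) (μ₁ μ₂ : ℝ) :
    Integrable (Function.uncurry (binormalDensity σ ρ μ₁ μ₂)) (volume.prod volume) := by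
  have hs : 0 < σ * Real.sqrt (1 - ρ ^ 2) := by positivity
  have hc : Continuous (Function.uncurry (binormalDensity σ ρ μ₁ μ₂)) := by
    unfold Function.uncurry binormalDensity quadForm; fun_prop
  refine (integrable_prod_iff' hc.aestronglyMeasurable).2 ⟨.of_forall fun u => ?_, ?_⟩
  · simp_rw [Function.uncurry_apply_pair, binormalDensity_eq_marginal_right hσ hρ]
    exact ((integrable_stdNormalPDF_affine _ hs).const_mul _).const_mul _
  · simp_rw [Function.uncurry_apply_pair, Real.norm_of_nonneg (binormalDensity_nonneg hσ _ _ _ _),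
      integral_binormalDensity_left hσ hρ]
    exact integrable_stdNormalPDF.comp_sub_right μ₂

theorem setIntegral_Ioi_binormalDensity_right (hσ : 0 < σ) (hρ : 0 < 1 - ρ ^ 2)
    (μ₁ μ₂ y : ℝ) :
    ∫ u in Ioi (0 : ℝ), binormalDensity σ ρ μ₁ μ₂ y u
      = (1 / σ) * stdNormalPDF ((y - μ₁) / σ) *
          stdNormalCDF ((μ₂ + ρ * ((y - μ₁) / σ)) / Real.sqrt (1 - ρ ^ 2)) := by
  simp_rw [binormalDensity_eq_marginal_left hσ hρ]
  rw [integral_const_mul, integral_const_mul,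
    setIntegral_Ioi_stdNormalPDF_affine _ (Real.sqrt_pos.2 hρ)]
  have := (Real.sqrt_pos.2 hρ).ne'
  field_simp

theorem integral_setIntegral_Ioi_binormalDensity (hσ : 0 < σ) (hρ : 0 < 1 - ρ ^ 2)
    (μ₁ μ₂ : ℝ) :
    ∫ y, ∫ u in Ioi (0 : ℝ), binormalDensity σ ρ μ₁ μ₂ y u = stdNormalCDF μ₂ := by
  have hint : Integrable (Function.uncurry (binormalDensity σ ρ μ₁ μ₂))
      (volume.prod (volume.restrict (Ioi 0))) :=
    (integrable_binormalDensity hσ hρ μ₁ μ₂).mono_measure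
      (Measure.prod_mono le_rfl Measure.restrict_le_self)
  rw [integral_integral_swap hint]
  simp_rw [integral_binormalDensity_left hσ hρ]
  simpa using setIntegral_Ioi_stdNormalPDF_affine μ₂ one_pos

end

/-- For the bivariate normal joint density, writing
`z := (y - μ₁)/σ`: (i) `∫₀^∞ f(y, u) du = (1/σ) φ(z) Φ((μ₂ + ρz)/√(1-ρ²))`;
(ii) `∫_ℝ ∫₀^∞ f(y, u) du dy = Φ(μ₂)`; consequently the conditional density of
`Y*` given `U* > 0` is `y ↦ (1/σ) φ(z) Φ((μ₂ + ρz)/√(1-ρ²)) / Φ(μ₂)`. -/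
theorem heckman_normal_conditional_density
    (σ ρ μ₁ μ₂ : ℝ) (hσ : 0 < σ) (hρ₁ : -1 < ρ) (hρ₂ : ρ < 1) (y : ℝ) :
    (∫ u in Ioi (0 : ℝ), binormalDensity σ ρ μ₁ μ₂ y u
      = (1 / σ) * stdNormalPDF ((y - μ₁) / σ) *
          stdNormalCDF ((μ₂ + ρ * ((y - μ₁) / σ)) / Real.sqrt (1 - ρ ^ 2)))
    ∧ (∫ y', ∫ u in Ioi (0 : ℝ), binormalDensity σ ρ μ₁ μ₂ y' u
        = stdNormalCDF μ₂)
    ∧ ((∫ u in Ioi (0 : ℝ), binormalDensity σ ρ μ₁ μ₂ y u) /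
          ∫ y', ∫ u in Ioi (0 : ℝ), binormalDensity σ ρ μ₁ μ₂ y' u
        = (1 / σ) * stdNormalPDF ((y - μ₁) / σ) *
            stdNormalCDF ((μ₂ + ρ * ((y - μ₁) / σ)) / Real.sqrt (1 - ρ ^ 2)) /
            stdNormalCDF μ₂) := by
  have hρ : 0 < 1 - ρ ^ 2 := by nlinarith
  have hy := setIntegral_Ioi_binormalDensity_right hσ hρ μ₁ μ₂ y
  have hΦ := integral_setIntegral_Ioi_binormalDensity hσ hρ μ₁ μ₂
  exact ⟨hy, hΦ, by rw [hy, hΦ]⟩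
end

section
/- For every ν > 0 and every z ∈ ℝ, (1/(2π)) ∫_ℝ (1 + (z² + w²)/ν)^{−(ν+2)/2} dw = f_ν(z); that is, the marginal of the standard bivariate Student-t density with ν degrees of freedom is the univariate Student-t density with ν degrees of freedom. -/
open MeasureTheory Real Set

/-- The Student-`t` probability density function with `ν` degrees of freedom:
`f_ν(t) = Γ((ν+1)/2)/(√(νπ) Γ(ν/2)) (1 + t²/ν)^(-(ν+1)/2)`. -/
noncomputable def studentPDF (ν t : ℝ) : ℝ :=
  Real.Gamma ((ν + 1) / 2) / (Real.sqrt (ν * π) * Real.Gamma (ν / 2)) *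
    (1 + t ^ 2 / ν) ^ (-(ν + 1) / 2)

/-- The Student-`t` cumulative distribution function with `ν` degrees of
freedom. -/
noncomputable def studentCDF (ν x : ℝ) : ℝ := ∫ t in Iic x, studentPDF ν t

lemma rpow_mul_exp_neg_one_add_sq_mul (a x r : ℝ) :
    r ^ (a - 1) * exp (-((1 + x ^ 2) * r)) = r ^ (a - 1) * exp (-r) * exp (-r * x ^ 2) := by
  rw [mul_assoc, ← exp_add]
  ring_nf

lemma integral_rpow_mul_exp_neg_one_add_sq_mul (a : ℝ) {r : ℝ} (hr : 0 < r) :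
    ∫ x : ℝ, r ^ (a - 1) * exp (-((1 + x ^ 2) * r))
      = √π * (exp (-r) * r ^ (a - 1 / 2 - 1)) := by
  simp only [rpow_mul_exp_neg_one_add_sq_mul]
  rw [integral_const_mul, integral_gaussian, sqrt_div pi_pos.le, sqrt_eq_rpow r,
    show a - 1 / 2 - 1 = (a - 1) - 1 / 2 by ring, rpow_sub hr (a - 1) (1 / 2)]
  ring

/-- The kernel `r ^ (a - 1) * exp (-(1 + x ^ 2) * r)`, whose integral in `r` is
`Γ(a) (1 + x ^ 2) ^ (-a)`, is integrable on `ℝ × (0, ∞)` for `a > 1 / 2`. -/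
lemma integrable_rpow_mul_exp_neg_one_add_sq_mul {a : ℝ} (ha : 1 / 2 < a) :
    Integrable (fun p : ℝ × ℝ => p.2 ^ (a - 1) * exp (-((1 + p.1 ^ 2) * p.2)))
      (volume.prod (volume.restrict (Ioi 0))) := by
  have hmeas : Measurable
      (fun p : ℝ × ℝ => p.2 ^ (a - 1) * exp (-((1 + p.1 ^ 2) * p.2))) := by fun_prop
  rw [integrable_prod_iff' hmeas.aestronglyMeasurable]
  constructor
  · filter_upwards [ae_restrict_mem measurableSet_Ioi] with r hr
    simp only [rpow_mul_exp_neg_one_add_sq_mul]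
    exact (integrable_exp_neg_mul_sq hr).const_mul _
  · have hint : IntegrableOn (fun r : ℝ => √π * (exp (-r) * r ^ (a - 1 / 2 - 1))) (Ioi 0) :=
      (GammaIntegral_convergent (by linarith)).const_mul _
    refine IntegrableOn.congr_fun hint (fun r hr => ?_) measurableSet_Ioi
    have hr : 0 < r := hr
    have hnorm (x : ℝ) : ‖r ^ (a - 1) * exp (-((1 + x ^ 2) * r))‖
        = r ^ (a - 1) * exp (-((1 + x ^ 2) * r)) := norm_of_nonneg (by positivity)
    simp only [hnorm]
    exact (integral_rpow_mul_exp_neg_one_add_sq_mul a hr).symm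

/-- `∫ (1 + x ^ 2) ^ (-a) = √π Γ(a - 1 / 2) / Γ(a)` for `a > 1 / 2`. -/
lemma integral_one_add_sq_rpow_neg {a : ℝ} (ha : 1 / 2 < a) :
    ∫ x : ℝ, (1 + x ^ 2) ^ (-a) = √π * Gamma (a - 1 / 2) / Gamma a := by
  have ha0 : 0 < a := by linarith
  have hswap := integral_integral_swap (f := fun x r : ℝ =>
    r ^ (a - 1) * exp (-((1 + x ^ 2) * r))) (integrable_rpow_mul_exp_neg_one_add_sq_mul ha)
  have hleft (x : ℝ) : ∫ r in Ioi (0 : ℝ), r ^ (a - 1) * exp (-((1 + x ^ 2) * r))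
      = (1 + x ^ 2) ^ (-a) * Gamma a := by
    have hx : 0 < 1 + x ^ 2 := by positivity
    rw [integral_rpow_mul_exp_neg_mul_Ioi ha0 hx, one_div, inv_rpow hx.le, rpow_neg hx.le]
  have hright : ∫ r in Ioi (0 : ℝ), ∫ x : ℝ, r ^ (a - 1) * exp (-((1 + x ^ 2) * r))
      = √π * Gamma (a - 1 / 2) := by
    rw [Gamma_eq_integral (by linarith), ← integral_const_mul]
    exact setIntegral_congr_fun measurableSet_Ioi
      fun r hr => integral_rpow_mul_exp_neg_one_add_sq_mul a hr
  simp only [hleft] at hswap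
  rw [hright, integral_mul_const] at hswap
  rw [eq_div_iff (Gamma_pos_of_pos ha0).ne', hswap]

/-- For every `ν > 0` and `z ∈ ℝ`,
`(1/(2π)) ∫_ℝ (1 + (z² + w²)/ν)^(-(ν+2)/2) dw = f_ν(z)`: the marginal of the
standard bivariate Student-`t` density with `ν` degrees of freedom is the
univariate Student-`t` density with `ν` degrees of freedom. -/
theorem bivariate_student_marginal (ν : ℝ) (hν : 0 < ν) (z : ℝ) :
    (1 / (2 * π)) * ∫ w, (1 + (z ^ 2 + w ^ 2) / ν) ^ (-(ν + 2) / 2)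
      = studentPDF ν z := by
  set c : ℝ := 1 + z ^ 2 / ν with hc
  have hc0 : 0 < c := by positivity
  have hs : 0 < √(ν * c) := sqrt_pos.2 (by positivity)
  have hfactor (w : ℝ) : (1 + (z ^ 2 + w ^ 2) / ν) ^ (-(ν + 2) / 2)
      = c ^ (-(ν + 2) / 2) * (1 + (w / √(ν * c)) ^ 2) ^ (-((ν + 2) / 2)) := by
    rw [← neg_div, ← mul_rpow hc0.le (by positivity), div_pow, sq_sqrt (by positivity)]
    congr 1
    field_simp
    rw [hc]
    field_simp
    ring
  have hpow : c ^ (-(ν + 1) / 2) = c ^ (-(ν + 2) / 2) * √c := by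
    rw [sqrt_eq_rpow, ← rpow_add hc0]
    ring_nf
  have hGamma : Gamma ((ν + 2) / 2) = ν / 2 * Gamma (ν / 2) := by
    rw [← Gamma_add_one (by positivity)]
    ring_nf
  have hG0 : 0 < Gamma (ν / 2) := Gamma_pos_of_pos (by positivity)
  simp only [hfactor]
  rw [integral_const_mul, Measure.integral_comp_div (fun x : ℝ => (1 + x ^ 2) ^ (-((ν + 2) / 2))),
    integral_one_add_sq_rpow_neg (by linarith), hGamma, abs_of_pos hs, studentPDF, ← hc, hpow,
    show (ν + 2) / 2 - 1 / 2 = (ν + 1) / 2 by ring, sqrt_mul hν.le, sqrt_mul hν.le, smul_eq_mul]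
  have hν2 : √ν ^ 2 = ν := sq_sqrt hν.le
  have hπ2 : √π ^ 2 = π := sq_sqrt pi_pos.le
  have hν0 : 0 < √ν := sqrt_pos.2 hν
  have hπ0 : 0 < √π := sqrt_pos.2 pi_pos
  field_simp
  rw [hν2, hπ2, mul_comm]
end

section
/- For every ν > 0 and all z, w ∈ ℝ, (1/(2π)) (1 + (z² + w²)/ν)^{−(ν+2)/2} = f_ν(z) · √((ν+1)/(ν+z²)) · f_{ν+1}(w · √((ν+1)/(ν+z²))). In other words, if (Z₁, Z₂) has the standard bivariate Student-t density with ν degrees of freedom, then conditionally on Z₁ = z the variable √((ν+1)/(ν+z²)) · Z₂ has the Student-t distribution with ν+1 degrees of freedom. -/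
open MeasureTheory Real Set

/-- For every `ν > 0` and `z, w ∈ ℝ`,
`(1/(2π)) (1 + (z² + w²)/ν)^(-(ν+2)/2)
  = f_ν(z) · √((ν+1)/(ν+z²)) · f_{ν+1}(w √((ν+1)/(ν+z²)))`:
conditionally on `Z₁ = z`, the variable `√((ν+1)/(ν+z²)) Z₂` is Student-`t`
with `ν+1` degrees of freedom. -/
theorem bivariate_student_conditional (ν : ℝ) (hν : 0 < ν) (z w : ℝ) :
    (1 / (2 * π)) * (1 + (z ^ 2 + w ^ 2) / ν) ^ (-(ν + 2) / 2)
      = studentPDF ν z * Real.sqrt ((ν + 1) / (ν + z ^ 2)) *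
          studentPDF (ν + 1) (w * Real.sqrt ((ν + 1) / (ν + z ^ 2))) := by
  have hz : 0 < ν + z ^ 2 := by positivity
  have ha : 0 < 1 + z ^ 2 / ν := by positivity
  have hb : 0 < 1 + w ^ 2 / (ν + z ^ 2) := by positivity
  have hfactor : 1 + (z ^ 2 + w ^ 2) / ν
      = (1 + z ^ 2 / ν) * (1 + w ^ 2 / (ν + z ^ 2)) := by
    field_simp
    ring
  have harg : 1 + (w * √((ν + 1) / (ν + z ^ 2))) ^ 2 / (ν + 1)
      = 1 + w ^ 2 / (ν + z ^ 2) := by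
    rw [mul_pow, Real.sq_sqrt (by positivity)]
    field_simp
  have hscale : √((ν + 1) / (ν + z ^ 2)) = √(ν + 1) / (√ν * √(1 + z ^ 2 / ν)) := by
    rw [← Real.sqrt_mul hν.le, ← Real.sqrt_div (by positivity)]
    congr 2
    field_simp
  have hpow : (1 + z ^ 2 / ν) ^ (-(ν + 1) / 2)
      = (1 + z ^ 2 / ν) ^ (-(ν + 2) / 2) * √(1 + z ^ 2 / ν) := by
    rw [Real.sqrt_eq_rpow, ← Real.rpow_add ha]
    ring_nf
  have hGamma : Real.Gamma ((ν + 1 + 1) / 2) = ν / 2 * Real.Gamma (ν / 2) := by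
    rw [← Real.Gamma_add_one (by positivity)]
    ring_nf
  have hexp : -(ν + 1 + 1) / 2 = -(ν + 2) / 2 := by ring
  have hG₀ : 0 < Real.Gamma (ν / 2) := Real.Gamma_pos_of_pos (by positivity)
  have hG₁ : 0 < Real.Gamma ((ν + 1) / 2) := Real.Gamma_pos_of_pos (by positivity)
  have hs : 0 < √(1 + z ^ 2 / ν) := Real.sqrt_pos.2 ha
  have hsν : 0 < √ν := Real.sqrt_pos.2 hν
  have hsν₁ : 0 < √(ν + 1) := Real.sqrt_pos.2 (by positivity)
  have hsπ : 0 < √π := Real.sqrt_pos.2 Real.pi_pos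
  have hconst : Real.Gamma ((ν + 1) / 2) / (√ν * √π * Real.Gamma (ν / 2)) *
      √(1 + z ^ 2 / ν) * (√(ν + 1) / (√ν * √(1 + z ^ 2 / ν))) *
      (ν / 2 * Real.Gamma (ν / 2) / (√(ν + 1) * √π * Real.Gamma ((ν + 1) / 2)))
      = 1 / (2 * π) := by
    calc _ = ν / (2 * √ν ^ 2 * √π ^ 2) := by
          generalize √(1 + z ^ 2 / ν) = s at hs ⊢
          field_simp
      _ = 1 / (2 * π) := by
          rw [Real.sq_sqrt hν.le, Real.sq_sqrt Real.pi_pos.le]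
          field_simp
  unfold studentPDF
  rw [harg, hscale, hpow, hGamma, hexp, hfactor, Real.mul_rpow ha.le hb.le,
    Real.sqrt_mul hν.le, Real.sqrt_mul (by positivity : 0 ≤ ν + 1), ← hconst]
  ring
end

section
/- Let σ > 0, −1 < ρ < 1, μ₁, μ₂ ∈ ℝ and ν > 0, and consider the bivariate Student-t joint density f(y, u) := (1/(2π σ √(1 − ρ²))) (1 + q(y − μ₁, u − μ₂)/ν)^{−(ν+2)/2}. Then for every y ∈ ℝ, writing z := (y − μ₁)/σ: ∫₀^∞ f(y, u) du = (1/σ) · f_ν(z) · F_{ν+1}( √((ν+1)/(ν+z²)) · (μ₂ + ρ z)/√(1 − ρ²) ). -/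
open MeasureTheory Real Set

/-- The bivariate Student-`t` joint density with `ν` degrees of freedom,
location `(μ₁, μ₂)` and covariance matrix `Σ = [[σ², ρσ], [ρσ, 1]]`. -/
noncomputable def bistudentDensity (ν σ ρ μ₁ μ₂ y u : ℝ) : ℝ :=
  (1 / (2 * π * σ * Real.sqrt (1 - ρ ^ 2))) *
    (1 + quadForm σ ρ (y - μ₁) (u - μ₂) / ν) ^ (-(ν + 2) / 2)

/-- The affine substitution `t = x - c u` turns a half-line integral into an integral over
`Iic x`. -/
theorem mul_setIntegral_Ioi_comp_sub_mul (g : ℝ → ℝ) (x : ℝ) {c : ℝ} (hc : 0 < c) :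
    c * ∫ u in Ioi (0 : ℝ), g (x - c * u) = ∫ t in Iic x, g t := by
  have h₁ := integral_comp_mul_left_Ioi (fun t => g (x - t)) 0 hc
  have h₂ := (Measure.measurePreserving_sub_left volume x).setIntegral_preimage_emb
    (MeasurableEquiv.subLeft x).measurableEmbedding g (Iio x)
  have h₃ : (fun t : ℝ => x - t) ⁻¹' Iio x = Ioi 0 := by
    ext t
    simp
  rw [h₃] at h₂
  rw [h₁, mul_zero, smul_eq_mul, h₂, integral_Iic_eq_integral_Iio, mul_inv_cancel_left₀ hc.ne']

theorem quadForm_mul_left {σ ρ : ℝ} (hσ : σ ≠ 0) (hρ : 1 - ρ ^ 2 ≠ 0) (z b : ℝ) :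
    quadForm σ ρ (σ * z) b = z ^ 2 + (b - ρ * z) ^ 2 / (1 - ρ ^ 2) := by
  unfold quadForm
  field_simp
  ring

/-- The product of the normalizing constants of the marginal and conditional densities. -/
theorem studentPDF_mul_studentPDF_add_one {ν : ℝ} (hν : 0 < ν) (z t : ℝ) :
    studentPDF ν z * studentPDF (ν + 1) t =
      √ν / (2 * π * √(ν + 1)) *
        ((1 + z ^ 2 / ν) ^ (-(ν + 1) / 2) * (1 + t ^ 2 / (ν + 1)) ^ (-(ν + 2) / 2)) := by
  have hΓ : Real.Gamma ((ν + 1 + 1) / 2) = ν / 2 * Real.Gamma (ν / 2) := by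
    rw [← Real.Gamma_add_one (by positivity)]
    congr 1
    ring
  have h₁ : Real.Gamma (ν / 2) ≠ 0 := (Real.Gamma_pos_of_pos (by positivity)).ne'
  have h₂ : Real.Gamma ((ν + 1) / 2) ≠ 0 := (Real.Gamma_pos_of_pos (by positivity)).ne'
  have h₃ : √ν ≠ 0 := by positivity
  have h₄ : √(ν + 1) ≠ 0 := by positivity
  have h₅ : √π ≠ 0 := by positivity
  have hconst : Real.Gamma ((ν + 1) / 2) / (√(ν * π) * Real.Gamma (ν / 2)) *
      (Real.Gamma ((ν + 1 + 1) / 2) / (√((ν + 1) * π) * Real.Gamma ((ν + 1) / 2))) =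
      √ν / (2 * π * √(ν + 1)) := by
    rw [hΓ, Real.sqrt_mul hν.le, Real.sqrt_mul (by positivity)]
    field_simp
    rw [Real.sq_sqrt hν.le, Real.sq_sqrt pi_pos.le]
  unfold studentPDF
  rw [← hconst, show ν + 1 + 1 = ν + 2 by ring]
  ring

/-- The joint density factors as the marginal density times the conditional density. -/
theorem bistudentDensity_eq_mul {σ ρ ν : ℝ} (hσ : 0 < σ) (hρ₁ : -1 < ρ) (hρ₂ : ρ < 1)
    (hν : 0 < ν) (μ₁ μ₂ y u : ℝ) :
    bistudentDensity ν σ ρ μ₁ μ₂ y u =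
      (1 / σ) * studentPDF ν ((y - μ₁) / σ) *
        (√((ν + 1) / (ν + ((y - μ₁) / σ) ^ 2)) / √(1 - ρ ^ 2) *
          studentPDF (ν + 1)
            (√((ν + 1) / (ν + ((y - μ₁) / σ) ^ 2)) *
                ((μ₂ + ρ * ((y - μ₁) / σ)) / √(1 - ρ ^ 2)) -
              √((ν + 1) / (ν + ((y - μ₁) / σ) ^ 2)) / √(1 - ρ ^ 2) * u)) := by
  have hρ : 0 < 1 - ρ ^ 2 := by nlinarith
  obtain ⟨z, hz⟩ : ∃ z, z = (y - μ₁) / σ := ⟨_, rfl⟩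
  have hy : y - μ₁ = σ * z := by rw [hz]; field_simp
  rw [← hz, bistudentDensity, hy, quadForm_mul_left hσ.ne' hρ.ne']
  have hs : √(1 - ρ ^ 2) ^ 2 = 1 - ρ ^ 2 := Real.sq_sqrt hρ.le
  have hs₀ : 0 < √(1 - ρ ^ 2) := Real.sqrt_pos.2 hρ
  have hD : 0 < ν + z ^ 2 := by positivity
  set k := √((ν + 1) / (ν + z ^ 2)) with hk
  set s := √(1 - ρ ^ 2)
  have hk₂ : k ^ 2 = (ν + 1) / (ν + z ^ 2) := Real.sq_sqrt (by positivity)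
  set t := k * ((μ₂ + ρ * z) / s) - k / s * u with ht
  have ht₂ : t ^ 2 / (ν + 1) = (u - μ₂ - ρ * z) ^ 2 / ((ν + z ^ 2) * (1 - ρ ^ 2)) := by
    have : t ^ 2 = k ^ 2 * (u - μ₂ - ρ * z) ^ 2 / s ^ 2 := by
      rw [ht]
      field_simp
      ring
    rw [this, hk₂, hs]
    field_simp
  have hfac : 1 + (z ^ 2 + (u - μ₂ - ρ * z) ^ 2 / (1 - ρ ^ 2)) / ν =
      (1 + z ^ 2 / ν) * (1 + t ^ 2 / (ν + 1)) := by
    rw [ht₂]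
    field_simp
    ring
  have hA : (1 + z ^ 2 / ν) ^ (-(ν + 2) / 2) =
      (1 + z ^ 2 / ν) ^ (-(ν + 1) / 2) * (√ν / √(ν + z ^ 2)) := by
    rw [show -(ν + 2) / 2 = -(ν + 1) / 2 + -(1 / 2) by ring, Real.rpow_add (by positivity),
      Real.rpow_neg (by positivity), ← Real.sqrt_eq_rpow,
      show 1 + z ^ 2 / ν = (ν + z ^ 2) / ν by field_simp, Real.sqrt_div hD.le, inv_div]
  have hk' : k = √(ν + 1) / √(ν + z ^ 2) := Real.sqrt_div (by positivity) _
  rw [hfac, Real.mul_rpow (by positivity) (by positivity), hA]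
  trans 1 / σ * (k / s) * (studentPDF ν z * studentPDF (ν + 1) t)
  · rw [studentPDF_mul_studentPDF_add_one hν, hk']
    have : √(ν + 1) ≠ 0 := by positivity
    field_simp
  · ring

/-- For the bivariate Student-`t` joint density, for every `y`,
writing `z := (y - μ₁)/σ`:
`∫₀^∞ f(y, u) du = (1/σ) f_ν(z) F_{ν+1}(√((ν+1)/(ν+z²)) (μ₂ + ρz)/√(1-ρ²))`. -/
theorem heckman_student_unnormalized_density
    (σ ρ μ₁ μ₂ ν : ℝ) (hσ : 0 < σ) (hρ₁ : -1 < ρ) (hρ₂ : ρ < 1) (hν : 0 < ν)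
    (y : ℝ) :
    ∫ u in Ioi (0 : ℝ), bistudentDensity ν σ ρ μ₁ μ₂ y u
      = (1 / σ) * studentPDF ν ((y - μ₁) / σ) *
          studentCDF (ν + 1)
            (Real.sqrt ((ν + 1) / (ν + ((y - μ₁) / σ) ^ 2)) *
              ((μ₂ + ρ * ((y - μ₁) / σ)) / Real.sqrt (1 - ρ ^ 2))) := by
  have hρ : 0 < 1 - ρ ^ 2 := by nlinarith
  have hc : 0 < √((ν + 1) / (ν + ((y - μ₁) / σ) ^ 2)) / √(1 - ρ ^ 2) := by positivity
  simp_rw [bistudentDensity_eq_mul hσ hρ₁ hρ₂ hν]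
  rw [integral_const_mul, integral_const_mul, mul_setIntegral_Ioi_comp_sub_mul _ _ hc, studentCDF]
end
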